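/- There exists σ₂ > 0 such that for every σ ∈ [0, σ₂], every open set Ω ⊆ ℝ² with Lebesgue measure π, and every infinitely differentiable function v : ℝ² → ℝ with compact support contained in Ω, one has (1/2)∫_{ℝ²}(Δv)² dx − (σ²/2)∫_{ℝ²}|∇v|² dx − ∫_{ℝ²} v dx ≥ inf { (1/2)∫_{ℝ²}(Δw)² dx − (σ²/2)∫_{ℝ²}|∇w|² dx − ∫_{ℝ²} w dx : w infinitely differentiable with compact support contained in the open unit disk }. -/

import Mathlib

open MeasureTheory Real

/-- The Laplacian of `f : ℝ^N → ℝ`: the sum of the second partial derivatives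
`∑ i, ∂²f/∂xᵢ²` (the trace of the Hessian). -/
noncomputable def laplacian {N : ℕ} (f : EuclideanSpace ℝ (Fin N) → ℝ)
    (x : EuclideanSpace ℝ (Fin N)) : ℝ :=
  ∑ i : Fin N, fderiv ℝ (fun y => fderiv ℝ f y (EuclideanSpace.single i 1)) x
    (EuclideanSpace.single i 1)

/-! ### Part A: the sharp planar Sobolev (isoperimetric) inequality -/

section PartA

theorem cs_prod_line {E : Type*} [NormedAddCommGroup E] [NormedSpace ℝ E] (e : E) (he : ‖e‖ = 1)
    (c : ℝ → ℝ) (hc : Continuous c) (a b : E → ℝ) (ha : Continuous a) (hb : Continuous b)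
    (hac : HasCompactSupport a) (hbc : HasCompactSupport b) :
    Continuous (fun p : E × ℝ => c p.2 * (a p.1 * b (p.1 + p.2 • e))) ∧
    HasCompactSupport (fun p : E × ℝ => c p.2 * (a p.1 * b (p.1 + p.2 • e))) := by
  constructor
  · fun_prop
  · obtain ⟨R1, h1⟩ := hac.isCompact.isBounded.exists_norm_le
    obtain ⟨R2, h2⟩ := hbc.isCompact.isBounded.exists_norm_le
    apply HasCompactSupport.intro (hac.isCompact.prod (isCompact_closedBall (0:ℝ) (R1 + R2)))
    rintro ⟨x, r⟩ hx
    simp only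
    by_contra hne
    have hax : a x ≠ 0 := fun h => hne (by simp [h])
    have hbx : b (x + r • e) ≠ 0 := fun h => hne (by simp [h])
    have hx1 := subset_tsupport a hax
    have hx2 := subset_tsupport b hbx
    apply hx
    refine ⟨hx1, ?_⟩
    rw [mem_closedBall_zero_iff]
    have : r • e = (x + r • e) - x := by abel
    calc ‖r‖ = ‖r • e‖ := by rw [norm_smul, he, mul_one]
      _ = ‖(x + r • e) - x‖ := by rw [← this]
      _ ≤ ‖x + r • e‖ + ‖x‖ := norm_sub_le _ _
      _ ≤ R1 + R2 := by linarith [h1 _ hx1, h2 _ hx2]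

theorem cs_line {E : Type*} [NormedAddCommGroup E] [NormedSpace ℝ E] (e : E) (he : ‖e‖ = 1)
    (c : ℝ → ℝ) (b : E → ℝ) (hbc : HasCompactSupport b) (x : E) :
    HasCompactSupport (fun r : ℝ => c r * b (x + r • e)) := by
  obtain ⟨R2, h2⟩ := hbc.isCompact.isBounded.exists_norm_le
  apply HasCompactSupport.intro (isCompact_closedBall (0:ℝ) (R2 + ‖x‖))
  intro r hr
  by_contra hne
  have hbx : b (x + r • e) ≠ 0 := fun h => hne (by simp [h])
  have hx2 := subset_tsupport b hbx
  apply hr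
  rw [mem_closedBall_zero_iff]
  have : r • e = (x + r • e) - x := by abel
  calc ‖r‖ = ‖r • e‖ := by rw [norm_smul, he, mul_one]
      _ = ‖(x + r • e) - x‖ := by rw [← this]
      _ ≤ ‖x + r • e‖ + ‖x‖ := norm_sub_le _ _
      _ ≤ R2 + ‖x‖ := by linarith [h2 _ hx2]

theorem line_identity {E : Type*} [NormedAddCommGroup E] [NormedSpace ℝ E] [MeasurableSpace E]
    [BorelSpace E] [FiniteDimensional ℝ E] (μ : Measure E) [μ.IsAddHaarMeasure]
    (u : E → ℝ) (hu : ContDiff ℝ 1 u) (huc : HasCompactSupport u) (e : E) (he : ‖e‖ = 1) :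
    ∫ r in Set.Ioi (0:ℝ), r * ∫ x, fderiv ℝ u x e * fderiv ℝ u (x + r • e) e ∂μ
      = - ∫ x, u x ^ 2 ∂μ := by
  set g : E → ℝ := fun x => fderiv ℝ u x e with hg
  have hgc : Continuous g := (hu.continuous_fderiv one_ne_zero).clm_apply continuous_const
  have hgs : HasCompactSupport g := huc.fderiv_apply (𝕜 := ℝ) e
  have hd : ∀ x : E, ∀ r : ℝ, HasDerivAt (fun r : ℝ => u (x + r • e)) (g (x + r • e)) r := by
    intro x r
    have h1 : HasFDerivAt u (fderiv ℝ u (x + r • e)) (x + r • e) :=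
      (hu.differentiable (by simp) _).hasFDerivAt
    have h2 : HasDerivAt (fun r : ℝ => x + r • e) e r := by
      simpa using ((hasDerivAt_id r).smul_const e).const_add x
    exact h1.comp_hasDerivAt r h2
  have intg : ∀ (c : ℝ → ℝ) (hc : Continuous c) (a b : E → ℝ) (ha : Continuous a)
      (hb : Continuous b) (hac : HasCompactSupport a) (hbc : HasCompactSupport b),
      Integrable (fun p : E × ℝ => c p.2 * (a p.1 * b (p.1 + p.2 • e)))
        (μ.prod (volume.restrict (Set.Ioi (0:ℝ)))) := by
    intro c hc a b ha hb hac hbc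
    obtain ⟨h1, h2⟩ := cs_prod_line e he c hc a b ha hb hac hbc
    have : Integrable (fun p : E × ℝ => c p.2 * (a p.1 * b (p.1 + p.2 • e))) (μ.prod volume) :=
      h1.integrable_of_hasCompactSupport h2
    refine this.mono_measure ?_
    exact Measure.prod_mono le_rfl Measure.restrict_le_self
  have cline : ∀ x, Continuous (fun r : ℝ => x + r • e) := fun x => by fun_prop
  have tz : ∀ (c : ℝ → ℝ) (b : E → ℝ) (hbc : HasCompactSupport b) (x : E),
      Filter.Tendsto (fun r : ℝ => c r * b (x + r • e)) Filter.atTop (nhds 0) := by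
    intro c b hbc x
    exact (cs_line e he c b hbc x).is_zero_at_infty.mono_left atTop_le_cocompact
  -- inner integrals
  have s1 : ∀ x, ∫ r in Set.Ioi (0:ℝ), r * g (x + r • e) = - ∫ r in Set.Ioi (0:ℝ), u (x + r • e) := by
    intro x
    have := integral_Ioi_mul_deriv_eq_deriv_mul (a := (0:ℝ)) (a' := 0) (b' := 0)
      (u := fun r : ℝ => r) (u' := fun _ => 1) (v := fun r => u (x + r • e))
      (v' := fun r => g (x + r • e)) (fun r _ => hasDerivAt_id r) (fun r _ => hd x r) ?_ ?_ ?_ ?_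
    · simpa using this
    · exact (Continuous.integrable_of_hasCompactSupport (by fun_prop)
        (cs_line e he (fun r => r) g hgs x)).integrableOn
    · exact (Continuous.integrable_of_hasCompactSupport
        (continuous_const.mul (hu.continuous.comp (cline x)))
        (cs_line e he (fun r => 1) u huc x)).integrableOn
    · have : Continuous ((fun r : ℝ => r) * fun r => u (x + r • e)) :=
        continuous_id.mul (hu.continuous.comp (cline x))
      have h := this.tendsto 0
      simp only [Pi.mul_apply, zero_mul] at h
      exact h.mono_left nhdsWithin_le_nhds
    · exact tz (fun r => r) u huc x
  have s2 : ∀ x, ∫ r in Set.Ioi (0:ℝ), g (x + r • e) = - u x := by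
    intro x
    have := integral_Ioi_of_hasDerivAt_of_tendsto (f := fun r : ℝ => u (x + r • e))
      (f' := fun r => g (x + r • e)) (a := 0) (m := 0)
      (hu.continuous.comp (cline x)).continuousWithinAt (fun r _ => hd x r) ?_ ?_
    · simpa using this
    · have := (cs_line e he (fun r => 1) g hgs x)
      simp only [one_mul] at this
      exact (Continuous.integrable_of_hasCompactSupport (by fun_prop) this).integrableOn
    · simpa using tz (fun _ => 1) u huc x
  have s3 : ∀ r : ℝ, ∫ x, g x * u (x + r • e) ∂μ = - ∫ x, u x * g (x + r • e) ∂μ := by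
    intro r
    have hsh : ∀ x, fderiv ℝ (fun x => u (x + r • e)) x e = g (x + r • e) := by
      intro x
      rw [fderiv_comp_add_right]
    have hus : HasCompactSupport (fun x => u (x + r • e)) :=
      huc.comp_homeomorph (Homeomorph.addRight (r • e))
    have := integral_mul_fderiv_eq_neg_fderiv_mul_of_integrable (μ := μ) (f := u)
      (g := fun x => u (x + r • e)) (v := e) ?_ ?_ ?_ ?_ ?_
    · simp only [hsh] at this
      rw [this, neg_neg]
    · refine Continuous.integrable_of_hasCompactSupport (hgc.mul (hu.continuous.comp (by fun_prop))) ?_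
      exact hgs.mul_right
    · simp only [hsh]
      refine Continuous.integrable_of_hasCompactSupport (hu.continuous.mul (hgc.comp (by fun_prop))) ?_
      exact huc.mul_right
    · refine Continuous.integrable_of_hasCompactSupport (hu.continuous.mul (hu.continuous.comp (by fun_prop))) ?_
      exact huc.mul_right
    · exact fun x _ => hu.differentiable (by simp) x
    · exact fun x _ => (hu.differentiable (by simp) _).comp x (by fun_prop)
  calc ∫ r in Set.Ioi (0:ℝ), r * ∫ x, g x * g (x + r • e) ∂μ
      = ∫ r in Set.Ioi (0:ℝ), ∫ x, r * (g x * g (x + r • e)) ∂μ := by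
        simp only [integral_const_mul]
    _ = ∫ x, (∫ r in Set.Ioi (0:ℝ), r * (g x * g (x + r • e))) ∂μ :=
        (integral_integral_swap (intg (fun r => r) continuous_id g g hgc hgc hgs hgs)).symm
    _ = ∫ x, (- ∫ r in Set.Ioi (0:ℝ), 1 * (g x * u (x + r • e))) ∂μ := by
        congr 1; ext x
        have : ∀ r : ℝ, r * (g x * g (x + r • e)) = g x * (r * g (x + r • e)) := fun r => by ring
        simp only [this, integral_const_mul, s1, one_mul]; ring
    _ = - ∫ r in Set.Ioi (0:ℝ), ∫ x, 1 * (g x * u (x + r • e)) ∂μ := by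
        rw [integral_neg, integral_integral_swap (intg (fun r => 1) continuous_const g u hgc
          hu.continuous hgs huc)]
    _ = ∫ r in Set.Ioi (0:ℝ), ∫ x, 1 * (u x * g (x + r • e)) ∂μ := by
        rw [← integral_neg]; simp only [one_mul, s3, neg_neg]
    _ = ∫ x, (∫ r in Set.Ioi (0:ℝ), 1 * (u x * g (x + r • e))) ∂μ :=
        (integral_integral_swap (intg (fun r => 1) continuous_const u g hu.continuous hgc huc hgs)).symm
    _ = - ∫ x, u x ^ 2 ∂μ := by
        rw [← integral_neg]
        congr 1; ext x
        simp only [one_mul, integral_const_mul, s2]; ring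

theorem polar_E2 (f : EuclideanSpace ℝ (Fin 2) → ℝ) :
    ∫ z, f z = ∫ p in Set.Ioi (0:ℝ) ×ˢ Set.Ioo (-π) π, p.1 * f (p.1 • !₂[cos p.2, sin p.2]) := by
  have h1 := ((volume_preserving_finTwoArrow ℝ).symm _)
  have h2 := (EuclideanSpace.volume_preserving_symm_measurableEquiv_toLp (Fin 2)).symm _
  have h3 := h2.comp h1
  have := h3.integral_comp' (f := (MeasurableEquiv.finTwoArrow (α := ℝ)).symm.trans
    (MeasurableEquiv.toLp 2 (Fin 2 → ℝ))) f
  rw [← this, ← integral_comp_polarCoord_symm]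
  apply setIntegral_congr_fun
  · exact polarCoord.open_target.measurableSet
  · rintro ⟨r, θ⟩ _
    simp only [smul_eq_mul]
    congr 2
    ext i
    fin_cases i <;> simp [polarCoord, MeasurableEquiv.finTwoArrow]

theorem norm_unit (θ : ℝ) : ‖(!₂[cos θ, sin θ] : EuclideanSpace ℝ (Fin 2))‖ = 1 := by
  rw [EuclideanSpace.norm_eq]
  simp

theorem refl_bound {E : Type*} [NormedAddCommGroup E] [InnerProductSpace ℝ E] (a b n : E)
    (hn0 : n = 0 ∨ ‖n‖ = 1) :
    |inner ℝ a b - 2 * (inner ℝ a n * inner ℝ b n)| ≤ ‖a‖ * ‖b‖ := by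
  rcases hn0 with h | h
  · subst h
    simpa using abs_real_inner_le_norm a b
  · have e1 : inner ℝ a b - 2 * (inner ℝ a n * inner ℝ b n)
        = inner ℝ a (b - (2 * inner ℝ b n) • n) := by
      rw [inner_sub_right, inner_smul_right]; ring
    have e2 : ‖b - (2 * inner ℝ b n) • n‖ = ‖b‖ := by
      have : ‖b - (2 * inner ℝ b n) • n‖ ^ 2 = ‖b‖ ^ 2 := by
        rw [norm_sub_sq_real, inner_smul_right, norm_smul, mul_pow, h]
        simp only [norm_eq_abs, sq_abs]; ring
      exact (sq_eq_sq₀ (norm_nonneg _) (norm_nonneg _)).1 this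
    rw [e1, ← e2]
    exact abs_real_inner_le_norm _ _

local notation "E2" => EuclideanSpace ℝ (Fin 2)

theorem polar_part (u : E2 → ℝ) (hu : ContDiff ℝ 1 u) (huc : HasCompactSupport u) :
    ∫ z : E2, ∫ x : E2, fderiv ℝ u x (‖z‖⁻¹ • z) * fderiv ℝ u (x + z) (‖z‖⁻¹ • z)
      = - (2 * π) * ∫ x, u x ^ 2 := by
  have hfc : Continuous (fderiv ℝ u) := hu.continuous_fderiv one_ne_zero
  rw [polar_E2]
  obtain ⟨R, hR⟩ := huc.isCompact.isBounded.exists_norm_le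
  set e : ℝ → E2 := fun θ => !₂[cos θ, sin θ] with he
  have hec : Continuous e := by
    refine (PiLp.continuous_toLp 2 _).comp ?_
    refine continuous_pi fun i => ?_
    fin_cases i <;> simp <;> fun_prop
  set Γ : ℝ × ℝ → ℝ := fun p => ∫ x : E2, fderiv ℝ u x (e p.2) * fderiv ℝ u (x + p.1 • e p.2) (e p.2)
    with hΓ
  have hsupp : ∀ x, x ∉ tsupport u → fderiv ℝ u x = 0 := by
    intro x hx
    by_contra h
    exact hx (support_fderiv_subset ℝ h)
  have hΓc : Continuous Γ := by
    have e1 : Γ = fun p => ∫ x in tsupport u,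
        fderiv ℝ u x (e p.2) * fderiv ℝ u (x + p.1 • e p.2) (e p.2) := by
      ext p
      rw [hΓ]
      refine (setIntegral_eq_integral_of_forall_compl_eq_zero ?_).symm
      intro x hx
      simp [hsupp x hx]
    rw [e1]
    apply continuous_parametric_integral_of_continuous _ huc.isCompact
    fun_prop
  have hΓ0 : ∀ p : ℝ × ℝ, 2 * R < p.1 → Γ p = 0 := by
    intro p hp
    rw [hΓ]
    apply integral_eq_zero_of_ae
    filter_upwards with x
    by_cases h1 : x ∈ tsupport u
    · by_cases h2 : x + p.1 • e p.2 ∈ tsupport u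
      · exfalso
        have h3 : ‖p.1 • e p.2‖ ≤ 2 * R := by
          calc ‖p.1 • e p.2‖ = ‖(x + p.1 • e p.2) - x‖ := by congr 1; abel
            _ ≤ ‖x + p.1 • e p.2‖ + ‖x‖ := norm_sub_le _ _
            _ ≤ 2 * R := by linarith [hR _ h1, hR _ h2]
        rw [norm_smul, norm_unit, mul_one] at h3
        have := le_abs_self p.1
        rw [norm_eq_abs] at h3
        linarith
      · simp [hsupp _ h2]
    · simp [hsupp _ h1]
  have e2 : ∫ p in Set.Ioi (0:ℝ) ×ˢ Set.Ioo (-π) π, p.1 * (∫ x : E2,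
        fderiv ℝ u x (‖p.1 • e p.2‖⁻¹ • (p.1 • e p.2)) *
        fderiv ℝ u (x + p.1 • e p.2) (‖p.1 • e p.2‖⁻¹ • (p.1 • e p.2)))
      = ∫ p in Set.Ioi (0:ℝ) ×ˢ Set.Ioo (-π) π, p.1 * Γ p := by
    apply setIntegral_congr_fun (measurableSet_Ioi.prod measurableSet_Ioo)
    rintro ⟨r, θ⟩ ⟨hr, _⟩
    have hr' : (0:ℝ) < r := hr
    have : ‖r • e θ‖⁻¹ • (r • e θ) = e θ := by
      rw [norm_smul, norm_unit, mul_one, norm_eq_abs, abs_of_pos hr', smul_smul,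
        inv_mul_cancel₀ hr'.ne', one_smul]
    simp only [this, hΓ]
  rw [e2]
  have hIntg : IntegrableOn (fun p : ℝ × ℝ => p.1 * Γ p) (Set.Ioi (0:ℝ) ×ˢ Set.Ioo (-π) π)
      (volume.prod volume) := by
    have h1 : IntegrableOn (fun p : ℝ × ℝ => p.1 * Γ p) (Set.Icc (0:ℝ) (2 * R) ×ˢ Set.Icc (-π) π)
        (volume.prod volume) :=
      (continuous_fst.mul hΓc).continuousOn.integrableOn_compact (isCompact_Icc.prod isCompact_Icc)
    refine IntegrableOn.of_forall_sdiff_eq_zero h1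
      (measurableSet_Ioi.prod measurableSet_Ioo) ?_
    rintro ⟨r, θ⟩ ⟨⟨h2, h3⟩, h4⟩
    have : 2 * R < r := by
      by_contra hlt
      exact h4 ⟨⟨le_of_lt h2, not_lt.1 hlt⟩, ⟨h3.1.le, h3.2.le⟩⟩
    simp [hΓ0 (r, θ) this]
  have hvol : (volume : Measure (ℝ × ℝ)) = volume.prod volume := rfl
  rw [hvol, setIntegral_prod _ hIntg]
  rw [IntegrableOn, ← Measure.prod_restrict] at hIntg
  rw [integral_integral_swap (f := fun x y => x * Γ (x, y)) hIntg]
  have : ∀ θ : ℝ, ∫ r in Set.Ioi (0:ℝ), r * Γ (r, θ) = - ∫ x, u x ^ 2 := by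
    intro θ
    exact line_identity volume u hu huc (e θ) (norm_unit θ)
  simp only [this]
  rw [integral_const]
  simp [Real.pi_pos.le]
  ring_nf
  left; trivial

theorem iso_ineq (u : E2 → ℝ) (hu : ContDiff ℝ 1 u) (huc : HasCompactSupport u) :
    4 * π * ∫ x, u x ^ 2 ≤ (∫ x, ‖fderiv ℝ u x‖) ^ 2 := by
  have hfc : Continuous (fderiv ℝ u) := hu.continuous_fderiv one_ne_zero
  have hfs : HasCompactSupport (fderiv ℝ u) := huc.fderiv ℝ
  set G : E2 → E2 := fun x => (InnerProductSpace.toDual ℝ E2).symm (fderiv ℝ u x) with hG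
  have hGi : ∀ x y, inner ℝ (G x) y = fderiv ℝ u x y := by
    intro x y; simp [hG]
  have hGn : ∀ x, ‖G x‖ = ‖fderiv ℝ u x‖ := by intro x; simp [hG]
  have hGc : Continuous G := (LinearIsometryEquiv.continuous _).comp hfc
  have hGs : HasCompactSupport G := hfs.comp_left (by simp)
  have hGint : Integrable G := hGc.integrable_of_hasCompactSupport hGs
  have hG0 : ∫ x, G x = 0 := by
    refine ext_inner_right ℝ fun y => ?_
    rw [real_inner_comm, ← integral_inner hGint y]
    have hsw : ∀ x, inner ℝ y (G x) = fderiv ℝ u x y := fun x => by rw [real_inner_comm, hGi]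
    simp only [hsw, inner_zero_left]
    have := integral_mul_fderiv_eq_neg_fderiv_mul_of_integrable (μ := (volume : Measure E2))
      (f := fun _ => (1:ℝ)) (g := u) (v := y) (by simp) ?_ ?_ (by simp) ?_
    · simpa using this
    · simpa using (Continuous.integrable_of_hasCompactSupport (by fun_prop)
        (huc.fderiv_apply (𝕜 := ℝ) y) : Integrable _ (volume : Measure E2))
    · simpa using hu.continuous.integrable_of_hasCompactSupport huc
    · exact fun x _ => hu.differentiable (by simp) x
  set N : E2 → E2 := fun z => ‖z‖⁻¹ • z with hN
  have hNm : Measurable N := by fun_prop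
  have hdom : Integrable (fun p : E2 × E2 => ‖G p.1‖ * ‖G (p.1 + p.2)‖) (volume.prod volume) := by
    apply Continuous.integrable_of_hasCompactSupport (by fun_prop)
    obtain ⟨R, hR⟩ := hGs.isCompact.isBounded.exists_norm_le
    apply HasCompactSupport.intro (hGs.isCompact.prod (isCompact_closedBall (0:E2) (R + R)))
    rintro ⟨x, r⟩ hx
    simp only
    by_contra hne
    have hax : G x ≠ 0 := fun h => hne (by simp [h])
    have hbx : G (x + r) ≠ 0 := fun h => hne (by simp [h])
    have hx1 := subset_tsupport G hax
    have hx2 := subset_tsupport G hbx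
    apply hx
    refine ⟨hx1, ?_⟩
    rw [mem_closedBall_zero_iff]
    calc ‖r‖ = ‖(x + r) - x‖ := by congr 1; abel
      _ ≤ ‖x + r‖ + ‖x‖ := norm_sub_le _ _
      _ ≤ R + R := by linarith [hR _ hx1, hR _ hx2]
  have hNn : ∀ z, N z = 0 ∨ ‖N z‖ = 1 := by
    intro z
    by_cases hz : z = 0
    · left; simp [hN, hz]
    · right; simp [hN, norm_smul, hz]
  have hNle : ∀ z, ‖N z‖ ≤ 1 := by
    intro z
    rcases hNn z with h | h <;> simp [h]
  have i1 : Integrable (fun p : E2 × E2 => inner ℝ (G p.1) (G (p.1 + p.2))) (volume.prod volume) := by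
    refine hdom.mono' (Continuous.aestronglyMeasurable (by fun_prop)) ?_
    filter_upwards with p
    exact abs_real_inner_le_norm _ _
  have i2 : Integrable (fun p : E2 × E2 => inner ℝ (G p.1) (N p.2) * inner ℝ (G (p.1 + p.2)) (N p.2))
      (volume.prod volume) := by
    refine hdom.mono' (Measurable.aestronglyMeasurable ?_) ?_
    · have m1 : Measurable (fun p : E2 × E2 => N p.2) := hNm.comp measurable_snd
      have m2 : Measurable (fun p : E2 × E2 => G p.1) := hGc.measurable.comp measurable_fst
      have m3 : Measurable (fun p : E2 × E2 => G (p.1 + p.2)) :=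
        hGc.measurable.comp (measurable_fst.add measurable_snd)
      exact (m2.inner m1).mul (m3.inner m1)
    · filter_upwards with p
      rw [norm_mul]
      apply mul_le_mul
      · calc ‖inner ℝ (G p.1) (N p.2)‖ ≤ ‖G p.1‖ * ‖N p.2‖ := abs_real_inner_le_norm _ _
          _ ≤ ‖G p.1‖ * 1 := by gcongr; exact hNle _
          _ = _ := mul_one _
      · calc ‖inner ℝ (G (p.1 + p.2)) (N p.2)‖ ≤ ‖G (p.1 + p.2)‖ * ‖N p.2‖ := abs_real_inner_le_norm _ _
          _ ≤ ‖G (p.1 + p.2)‖ * 1 := by gcongr; exact hNle _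
          _ = _ := mul_one _
      · positivity
      · positivity
  have key : ∫ p : E2 × E2, (inner ℝ (G p.1) (G (p.1 + p.2))
      - 2 * (inner ℝ (G p.1) (N p.2) * inner ℝ (G (p.1 + p.2)) (N p.2))) ∂(volume.prod volume)
      ≤ ∫ p : E2 × E2, ‖G p.1‖ * ‖G (p.1 + p.2)‖ ∂(volume.prod volume) := by
    apply integral_mono (i1.sub (i2.const_mul 2)) hdom
    intro p
    exact (le_abs_self _).trans (refl_bound _ _ _ (hNn _))
  rw [integral_sub i1 (i2.const_mul 2), integral_const_mul, integral_prod _ i1,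
    integral_prod_symm _ i2, integral_prod _ hdom] at key
  have k1 : ∫ x : E2, ∫ z : E2, inner ℝ (G x) (G (x + z)) = 0 := by
    apply integral_eq_zero_of_ae
    filter_upwards with x
    have : ∫ z : E2, inner ℝ (G x) (G (x + z)) = inner ℝ (G x) (∫ z, G (x + z)) := by
      exact integral_inner (hGint.comp_add_left x) _
    rw [this, integral_add_left_eq_self (fun z => G z) x, hG0]; simp
  have k2 : ∫ x : E2, ∫ z : E2, ‖G x‖ * ‖G (x + z)‖ = (∫ x, ‖fderiv ℝ u x‖) ^ 2 := by
    have : ∀ x, ∫ z : E2, ‖G x‖ * ‖G (x + z)‖ = ‖G x‖ * ∫ z, ‖G z‖ := by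
      intro x
      rw [integral_const_mul, integral_add_left_eq_self (fun z => ‖G z‖) x]
    simp only [this]
    rw [integral_mul_const, sq]; simp only [hGn]
  have k3 := polar_part u hu huc
  simp only [hGi] at key
  simp only [hGi] at k1
  rw [k1, k2] at key
  simp only [hN] at key
  rw [k3] at key
  linarith

end PartA

/-! ### Part B: level sets -/

section PartB
local notation "E2" => EuclideanSpace ℝ (Fin 2)

theorem countable_level_deriv (g g' : ℝ → ℝ) (hg : ∀ r, HasDerivAt g (g' r) r) (c : ℝ) :
    {r | g r = c ∧ g' r ≠ 0}.Countable := by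
  set s := {r | g r = c ∧ g' r ≠ 0}
  have : DiscreteTopology s := by
    rw [discreteTopology_subtype_iff]
    rintro r ⟨h1, h2⟩
    have h3 := (hg r).eventually_ne (c := c) h2
    rw [← disjoint_iff, Filter.disjoint_principal_right]
    filter_upwards [h3] with z hz hz2
    exact hz hz2.1
  have : Countable s := countable_of_Lindelof_of_discrete
  exact this

theorem level_fderiv_null (u : E2 → ℝ) (hu : ContDiff ℝ 1 u) (c : ℝ) (e : E2) :
    ∀ᵐ x : E2, u x = c → fderiv ℝ u x e = 0 := by
  have hfc : Continuous (fderiv ℝ u) := hu.continuous_fderiv one_ne_zero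
  have hms : MeasurableSet {x : E2 | u x = c → fderiv ℝ u x e = 0} := by
    have h1 : MeasurableSet {x : E2 | u x = c} := (isClosed_eq hu.continuous continuous_const).measurableSet
    have h2 : MeasurableSet {x : E2 | fderiv ℝ u x e = 0} :=
      (isClosed_eq (hfc.clm_apply continuous_const) continuous_const).measurableSet
    exact h1.imp h2
  refine ae_mem_of_ae_add_linearMap_mem ((LinearMap.id (R := ℝ) (M := ℝ)).smulRight e) volume volume
    hms ?_
  intro y
  have h := countable_level_deriv (fun r : ℝ => u (y + r • e)) (fun r => fderiv ℝ u (y + r • e) e) ?_ c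
  · have h0 := h.ae_notMem (volume : Measure ℝ)
    filter_upwards [h0] with r hr
    simp only [LinearMap.smulRight_apply, LinearMap.id_apply] at hr ⊢
    intro h1
    by_contra h2
    exact hr ⟨h1, h2⟩
  · intro r
    have h1 : HasFDerivAt u (fderiv ℝ u (y + r • e)) (y + r • e) :=
      (hu.differentiable (by simp) _).hasFDerivAt
    have h2 : HasDerivAt (fun r : ℝ => y + r • e) e r := by
      simpa using ((hasDerivAt_id r).smul_const e).const_add y
    exact h1.comp_hasDerivAt r h2

theorem contDiff_partial (v : E2 → ℝ) (hv : ContDiff ℝ 2 v) (e : E2) :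
    ContDiff ℝ 1 (fun y => fderiv ℝ v y e) :=
  (hv.fderiv_right (m := 1) (by norm_num)).clm_apply contDiff_const

theorem laplacian_continuous (v : E2 → ℝ) (hv : ContDiff ℝ 2 v) : Continuous (laplacian v) := by
  unfold laplacian
  refine continuous_finsetSum _ fun i _ => ?_
  exact ((contDiff_partial v hv _).continuous_fderiv one_ne_zero).clm_apply continuous_const

theorem laplacian_supp (v : E2 → ℝ) (hc : HasCompactSupport v) :
    HasCompactSupport (laplacian v) := by
  apply HasCompactSupport.intro hc.isCompact
  intro x hx
  unfold laplacian
  apply Finset.sum_eq_zero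
  intro i _
  have h1 : x ∉ tsupport (fun y => fderiv ℝ v y (EuclideanSpace.single i 1)) :=
    fun h => hx (tsupport_fderiv_apply_subset ℝ _ h)
  have h2 : x ∉ tsupport (fun y => fderiv ℝ (fun y => fderiv ℝ v y (EuclideanSpace.single i 1)) y
      (EuclideanSpace.single i 1)) :=
    fun h => h1 (tsupport_fderiv_apply_subset ℝ _ h)
  exact image_eq_zero_of_notMem_tsupport (f := fun y => fderiv ℝ (fun y => fderiv ℝ v y
      (EuclideanSpace.single i 1)) y (EuclideanSpace.single i 1)) h2

theorem laplacian_level (v : E2 → ℝ) (hv : ContDiff ℝ 2 v) (c : ℝ) :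
    ∀ᵐ x : E2, v x = c → laplacian v x = 0 := by
  have h1 : ∀ᵐ x : E2, ∀ i : Fin 2, v x = c → fderiv ℝ v x (EuclideanSpace.single i 1) = 0 :=
    ae_all_iff.2 fun i => level_fderiv_null v (hv.of_le (by norm_num)) c _
  have h2 : ∀ᵐ x : E2, ∀ i : Fin 2, fderiv ℝ v x (EuclideanSpace.single i 1) = 0 →
      fderiv ℝ (fun y => fderiv ℝ v y (EuclideanSpace.single i 1)) x (EuclideanSpace.single i 1) = 0 :=
    ae_all_iff.2 fun i => level_fderiv_null _ (contDiff_partial v hv _) 0 _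
  filter_upwards [h1, h2] with x hx1 hx2 hx
  unfold laplacian
  exact Finset.sum_eq_zero fun i _ => hx2 i (hx1 i hx)

theorem norm_fderiv_sq (e : E2 →L[ℝ] ℝ) : ‖e‖ ^ 2 = ∑ i, (e (EuclideanSpace.single i 1)) ^ 2 := by
  set G := (InnerProductSpace.toDual ℝ E2).symm e with hG
  have h1 : ‖e‖ = ‖G‖ := by simp [hG]
  have h2 : ∀ y, e y = inner ℝ G y := by intro y; simp [hG]
  rw [h1, EuclideanSpace.norm_sq_eq]
  congr 1; ext i
  rw [h2, EuclideanSpace.inner_single_right]; simp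

/-- The flux function `D(t) = ∫_{v > t} (-Δ v)`. -/
noncomputable def fluxD (v : E2 → ℝ) (t : ℝ) : ℝ := ∫ x in {x | t < v x}, - laplacian v x

theorem meas_lt (v : E2 → ℝ) (hv : ContDiff ℝ 2 v) (t : ℝ) : MeasurableSet {x | t < v x} :=
  (isOpen_lt continuous_const hv.continuous).measurableSet

theorem laplacian_integrable (v : E2 → ℝ) (hv : ContDiff ℝ 2 v) (hc : HasCompactSupport v) :
    Integrable (laplacian v) :=
  (laplacian_continuous v hv).integrable_of_hasCompactSupport (laplacian_supp v hc)

theorem fluxD_continuous (v : E2 → ℝ) (hv : ContDiff ℝ 2 v) (hc : HasCompactSupport v) :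
    Continuous (fluxD v) := by
  rw [continuous_iff_continuousAt]
  intro t0
  have e1 : fluxD v = fun t => ∫ x, ({x | t < v x}).indicator (fun x => - laplacian v x) x := by
    ext t
    rw [integral_indicator (meas_lt v hv t)]; rfl
  rw [e1]
  have hi := laplacian_integrable v hv hc
  apply continuousAt_of_dominated (bound := fun x => ‖laplacian v x‖)
  · refine Filter.Eventually.of_forall fun t => ?_
    exact (hi.neg.indicator (meas_lt v hv t)).aestronglyMeasurable
  · refine Filter.Eventually.of_forall fun t => ?_
    filter_upwards with x
    refine (norm_indicator_le_norm_self _ _).trans ?_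
    simp
  · exact hi.norm
  · filter_upwards [laplacian_level v hv t0] with x hx
    by_cases h : v x = t0
    · have : (fun t => ({x | t < v x}).indicator (fun x => - laplacian v x) x) = fun t => 0 := by
        ext t
        simp [Set.indicator_apply, hx h]
      rw [this]; exact continuousAt_const
    · rcases lt_or_gt_of_ne h with h1 | h1
      · have : (fun t => ({x | t < v x}).indicator (fun x => - laplacian v x) x)
            =ᶠ[nhds t0] fun t => 0 := by
          filter_upwards [lt_mem_nhds h1] with t ht
          simp [not_lt.2 (le_of_lt ht)]
        exact continuousAt_const.congr this.symm
      · have : (fun t => ({x | t < v x}).indicator (fun x => - laplacian v x) x)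
            =ᶠ[nhds t0] fun t => - laplacian v x := by
          filter_upwards [gt_mem_nhds h1] with t ht
          have ht' : t < v x := ht
          simp [ht']
        exact continuousAt_const.congr this.symm

/-- integration by parts -/
theorem parts_comp (v : E2 → ℝ) (hv : ContDiff ℝ 2 v) (hc : HasCompactSupport v)
    (φ χ : ℝ → ℝ) (hφ : ∀ t, HasDerivAt φ (χ t) t) (hχ : Continuous χ) :
    ∫ x, φ (v x) * (- laplacian v x) = ∫ x, χ (v x) * ‖fderiv ℝ v x‖ ^ 2 := by
  have hφc : Continuous φ := continuous_iff_continuousAt.2 fun t => (hφ t).continuousAt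
  have hv1 : ContDiff ℝ 1 v := hv.of_le (by norm_num)
  have hvd : ∀ x, DifferentiableAt ℝ v x := fun x => hv1.differentiable (by simp) x
  have hfc : Continuous (fderiv ℝ v) := hv1.continuous_fderiv one_ne_zero
  have hd : ∀ x e, fderiv ℝ (fun x => φ (v x)) x e = χ (v x) * fderiv ℝ v x e := by
    intro x e
    have := (hφ (v x)).comp_hasFDerivAt x (hvd x).hasFDerivAt
    have h2 : HasFDerivAt (fun x => φ (v x)) (χ (v x) • fderiv ℝ v x) x := this
    rw [h2.fderiv]; simp
  have key : ∀ i : Fin 2, ∫ x, φ (v x) * fderiv ℝ (fun y => fderiv ℝ v y (EuclideanSpace.single i 1)) x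
      (EuclideanSpace.single i 1) = - ∫ x, χ (v x) * (fderiv ℝ v x (EuclideanSpace.single i 1)) ^ 2 := by
    intro i
    have hp := contDiff_partial v hv (EuclideanSpace.single i 1)
    have hps : HasCompactSupport (fun y => fderiv ℝ v y (EuclideanSpace.single i 1)) :=
      hc.fderiv_apply (𝕜 := ℝ) _
    have := integral_mul_fderiv_eq_neg_fderiv_mul_of_integrable (μ := (volume : Measure E2))
      (f := fun x => φ (v x)) (g := fun y => fderiv ℝ v y (EuclideanSpace.single i 1))
      (v := EuclideanSpace.single i 1) ?_ ?_ ?_ ?_ ?_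
    · rw [this]
      congr 2; ext x
      rw [hd]; ring
    · simp only [hd]
      refine Continuous.integrable_of_hasCompactSupport ?_ hps.mul_left
      have := hv.continuous
      fun_prop
    · refine Continuous.integrable_of_hasCompactSupport
        ((hφc.comp hv.continuous).mul ((hp.continuous_fderiv one_ne_zero).clm_apply continuous_const)) ?_
      exact (hps.fderiv_apply (𝕜 := ℝ) _).mul_left
    · refine Continuous.integrable_of_hasCompactSupport
        ((hφc.comp hv.continuous).mul hp.continuous) ?_
      exact hps.mul_left
    · exact fun x _ => (hφ (v x)).differentiableAt.comp x (hvd x)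
    · exact fun x _ => hp.differentiable (by simp) x
  have i1 : ∀ i : Fin 2, Integrable (fun x => φ (v x) * fderiv ℝ (fun y => fderiv ℝ v y (EuclideanSpace.single i 1)) x
      (EuclideanSpace.single i 1)) := by
    intro i
    have hp := contDiff_partial v hv (EuclideanSpace.single i 1)
    have hps : HasCompactSupport (fun y => fderiv ℝ v y (EuclideanSpace.single i 1)) :=
      hc.fderiv_apply (𝕜 := ℝ) _
    refine Continuous.integrable_of_hasCompactSupport
        ((hφc.comp hv.continuous).mul ((hp.continuous_fderiv one_ne_zero).clm_apply continuous_const)) ?_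
    exact (hps.fderiv_apply (𝕜 := ℝ) _).mul_left
  have i2 : ∀ i : Fin 2, Integrable (fun x => χ (v x) * (fderiv ℝ v x (EuclideanSpace.single i 1)) ^ 2) := by
    intro i
    have hps : HasCompactSupport (fun y => fderiv ℝ v y (EuclideanSpace.single i 1)) :=
      hc.fderiv_apply (𝕜 := ℝ) _
    have := hv.continuous
    refine Continuous.integrable_of_hasCompactSupport (by fun_prop) ?_
    simp only [sq]
    exact (hps.mul_right).mul_left
  have e1 : ∀ x, φ (v x) * (- laplacian v x) = - ∑ i : Fin 2, φ (v x) *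
      fderiv ℝ (fun y => fderiv ℝ v y (EuclideanSpace.single i 1)) x (EuclideanSpace.single i 1) := by
    intro x
    unfold laplacian
    rw [← Finset.mul_sum]; ring
  have e2 : ∀ x, χ (v x) * ‖fderiv ℝ v x‖ ^ 2
      = ∑ i : Fin 2, χ (v x) * (fderiv ℝ v x (EuclideanSpace.single i 1)) ^ 2 := by
    intro x
    rw [norm_fderiv_sq, Finset.mul_sum]
  simp only [e1, e2]
  rw [integral_neg, integral_finsetSum _ (fun i _ => i1 i), integral_finsetSum _ (fun i _ => i2 i),
    ← Finset.sum_neg_distrib]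
  exact Finset.sum_congr rfl fun i _ => by rw [key]; ring

theorem integral_laplacian (v : E2 → ℝ) (hv : ContDiff ℝ 2 v) (hc : HasCompactSupport v) :
    ∫ x, - laplacian v x = 0 := by
  have := parts_comp v hv hc (fun _ => 1) (fun _ => 0) (fun t => hasDerivAt_const t 1) continuous_const
  simpa using this

theorem exists_bound (v : E2 → ℝ) (hv : ContDiff ℝ 2 v) (hc : HasCompactSupport v) :
    ∃ M : ℝ, 0 < M ∧ ∀ x, |v x| < M := by
  obtain ⟨C, hC⟩ := hc.exists_bound_of_continuous hv.continuous
  exact ⟨max C 0 + 1, by positivity, fun x => lt_of_le_of_lt (hC x) (by linarith [le_max_left C 0])⟩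

theorem fluxD_zero (v : E2 → ℝ) (hv : ContDiff ℝ 2 v) (hc : HasCompactSupport v)
    (M : ℝ) (hM : ∀ x, |v x| < M) (t : ℝ) (ht : M ≤ |t|) : fluxD v t = 0 := by
  rcases le_total 0 t with h | h
  · rw [abs_of_nonneg h] at ht
    have : {x | t < v x} = ∅ := by
      ext x
      have := (abs_lt.1 (hM x)).2
      simp only [Set.mem_ofPred_eq, Set.mem_empty_iff_false, iff_false, not_lt]
      linarith
    simp [fluxD, this]
  · rw [abs_of_nonpos h] at ht
    have : {x | t < v x} = Set.univ := by
      ext x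
      have := (abs_lt.1 (hM x)).1
      simp only [Set.mem_ofPred_eq, Set.mem_univ, iff_true]
      linarith
    rw [fluxD, this, setIntegral_univ, integral_laplacian v hv hc]

theorem fluxD_supp (v : E2 → ℝ) (hv : ContDiff ℝ 2 v) (hc : HasCompactSupport v) :
    HasCompactSupport (fluxD v) := by
  obtain ⟨M, hM0, hM⟩ := exists_bound v hv hc
  apply HasCompactSupport.intro (isCompact_Icc (a := -M) (b := M))
  intro t ht
  apply fluxD_zero v hv hc M hM
  by_contra h
  exact ht (abs_le.1 (not_le.1 h).le)

theorem coarea_D (v : E2 → ℝ) (hv : ContDiff ℝ 2 v) (hc : HasCompactSupport v)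
    (χ : ℝ → ℝ) (hχ : Continuous χ) :
    ∫ x, χ (v x) * ‖fderiv ℝ v x‖ ^ 2 = ∫ t, χ t * fluxD v t := by
  obtain ⟨M, hM0, hM⟩ := exists_bound v hv hc
  have hd : ∀ t, HasDerivAt (fun s => ∫ τ in (-M)..s, χ τ) (χ t) t := fun t =>
    (intervalIntegral.integral_hasDerivAt_right
      (hχ.intervalIntegrable _ _) (hχ.stronglyMeasurableAtFilter _ _) hχ.continuousAt)
  rw [← parts_comp v hv hc _ χ hd hχ]
  have hi := laplacian_integrable v hv hc
  set S : Set (E2 × ℝ) := {p | p.2 < v p.1} with hS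
  have hSm : MeasurableSet S := by
    have := hv.continuous
    exact (isOpen_lt continuous_snd (by fun_prop)).measurableSet
  have hIntg : Integrable (fun p : E2 × ℝ => S.indicator (fun p => (- laplacian v p.1) * χ p.2) p)
      (volume.prod (volume.restrict (Set.Ioc (-M) M))) := by
    apply Integrable.indicator _ hSm
    exact Integrable.mul_prod (f := fun x => - laplacian v x) (g := χ) hi.neg
      ((hχ.integrableOn_Icc (a := -M) (b := M)).mono_set Set.Ioc_subset_Icc_self)
  have sw := integral_integral_swap (f := fun x t => S.indicator (fun p => (- laplacian v p.1) * χ p.2) (x, t)) hIntg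
  have l1 : ∀ x, ∫ t in Set.Ioc (-M) M, S.indicator (fun p => (- laplacian v p.1) * χ p.2) (x, t)
      = (∫ τ in (-M)..(v x), χ τ) * (- laplacian v x) := by
    intro x
    have hx := abs_lt.1 (hM x)
    rw [intervalIntegral.integral_of_le hx.1.le, mul_comm, ← integral_const_mul]
    rw [integral_Ioc_eq_integral_Ioo (y := v x), ← integral_indicator measurableSet_Ioo,
      ← integral_indicator measurableSet_Ioc]
    congr 1; ext t
    simp only [Set.indicator_apply, hS, Set.mem_ofPred_eq, Set.mem_Ioc, Set.mem_Ioo]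
    by_cases h1 : -M < t
    · by_cases h2 : t < v x
      · have : t ≤ M := by linarith
        simp [h1, h2, this]
      · simp [h2]
    · simp [h1]
  have l2 : ∀ t, ∫ x, S.indicator (fun p => (- laplacian v p.1) * χ p.2) (x, t) = χ t * fluxD v t := by
    intro t
    rw [fluxD, ← integral_const_mul, ← integral_indicator (meas_lt v hv t)]
    congr 1; ext x
    simp only [Set.indicator_apply, hS, Set.mem_ofPred_eq]
    split_ifs
    · ring
    · rfl
  simp only [l1, l2] at sw
  rw [sw]
  apply setIntegral_eq_integral_of_forall_compl_eq_zero
  intro t ht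
  have : fluxD v t = 0 := by
    apply fluxD_zero v hv hc M hM
    by_contra h
    have := abs_lt.1 (not_le.1 h)
    exact ht ⟨this.1, this.2.le⟩
  rw [this, mul_zero]

theorem fluxD_nonneg (v : E2 → ℝ) (hv : ContDiff ℝ 2 v) (hc : HasCompactSupport v) (t : ℝ) :
    0 ≤ fluxD v t := by
  by_contra hneg
  rw [not_le] at hneg
  have hD := fluxD_continuous v hv hc
  have hχ : Continuous (fun t => max (- fluxD v t) 0) := by fun_prop
  have h1 := coarea_D v hv hc _ hχ
  have h2 : 0 ≤ ∫ x, max (- fluxD v (v x)) 0 * ‖fderiv ℝ v x‖ ^ 2 :=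
    integral_nonneg fun x => by positivity
  have h3 : 0 < ∫ t, - (max (- fluxD v t) 0 * fluxD v t) := by
    apply Continuous.integral_pos_of_hasCompactSupport_nonneg_nonzero (x := t)
    · fun_prop
    · exact ((fluxD_supp v hv hc).mul_left).neg
    · intro s
      simp only [Pi.zero_apply]
      rcases le_total 0 (fluxD v s) with h | h
      · rw [max_eq_right (by linarith)]; simp
      · rw [max_eq_left (by linarith)]; nlinarith
    · rw [max_eq_left (by linarith)]
      have : 0 < fluxD v t * fluxD v t := mul_pos_of_neg_of_neg hneg hneg
      intro h; nlinarith
  rw [integral_neg, ← h1] at h3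
  linarith

theorem dirichlet_D (v : E2 → ℝ) (hv : ContDiff ℝ 2 v) (hc : HasCompactSupport v) :
    ∫ x, ‖fderiv ℝ v x‖ ^ 2 = ∫ t, fluxD v t := by
  simpa using coarea_D v hv hc (fun _ => 1) continuous_const

end PartB

section PartB2
local notation "E2" => EuclideanSpace ℝ (Fin 2)

theorem cs_int {α : Type*} [MeasurableSpace α] {μ : Measure α} (p q r : α → ℝ)
    (hp : Integrable p μ) (hq : Integrable q μ) (hr : Integrable r μ)
    (p0 : ∀ x, 0 ≤ p x) (r0 : ∀ x, 0 ≤ r x) (h : ∀ x, q x ^ 2 ≤ p x * r x) :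
    (∫ x, q x ∂μ) ^ 2 ≤ (∫ x, p x ∂μ) * ∫ x, r x ∂μ := by
  have key : ∀ l : ℝ, 0 ≤ (∫ x, p x ∂μ) * (l * l) + (2 * ∫ x, q x ∂μ) * l + ∫ x, r x ∂μ := by
    intro l
    have e : ∫ x, (l * l) * p x + (2 * l) * q x + r x ∂μ
        = (∫ x, p x ∂μ) * (l * l) + (2 * ∫ x, q x ∂μ) * l + ∫ x, r x ∂μ := by
      have i1 : Integrable (fun x => (l * l) * p x + (2 * l) * q x) μ :=
        (hp.const_mul _).add (hq.const_mul _)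
      rw [integral_add i1 hr,
        integral_add (hp.const_mul _) (hq.const_mul _), integral_const_mul, integral_const_mul]
      ring
    rw [← e]
    apply integral_nonneg
    intro x
    have h1 := h x
    have h2 := p0 x
    have h3 := r0 x
    simp only [Pi.zero_apply]
    rcases h2.eq_or_lt with h4 | h4
    · rw [← h4] at h1 ⊢
      have : q x = 0 := by nlinarith
      rw [this]; linarith
    · have : 0 ≤ p x * (l * l * p x + 2 * l * q x + r x) := by nlinarith [sq_nonneg (l * p x + q x)]
      exact nonneg_of_mul_nonneg_right this h4
  have := discrim_le_zero key
  unfold discrim at this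
  nlinarith

set_option maxHeartbeats 1000000 in
theorem level_ineq (v : E2 → ℝ) (hv : ContDiff ℝ 2 v) (hc : HasCompactSupport v)
    (χ : ℝ → ℝ) (hχ : Continuous χ) (χ0 : ∀ s, 0 ≤ χ s) (χz : χ 0 = 0) (a : ℝ) (ha : 0 < a) :
    4 * π * ((∫ s in (0:ℝ)..a, χ s) ^ 2 * volume.real {x | a ≤ v x})
      ≤ (∫ x, χ (v x)) * ∫ t, χ t * fluxD v t := by
  set φ : ℝ → ℝ := fun s => ∫ τ in (0:ℝ)..s, χ τ with hφ
  have hd : ∀ t, HasDerivAt φ (χ t) t := fun t =>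
    (intervalIntegral.integral_hasDerivAt_right
      (hχ.intervalIntegrable _ _) (hχ.stronglyMeasurableAtFilter _ _) hχ.continuousAt)
  have hφ1 : ContDiff ℝ 1 φ := by
    rw [contDiff_one_iff_deriv]
    refine ⟨fun t => (hd t).differentiableAt, ?_⟩
    have : deriv φ = χ := funext fun t => (hd t).deriv
    rw [this]; exact hχ
  have hv1 : ContDiff ℝ 1 v := hv.of_le (by norm_num)
  have hu : ContDiff ℝ 1 (fun x => φ (v x)) := hφ1.comp hv1
  have huc : HasCompactSupport (fun x => φ (v x)) :=
    hc.comp_left (g := φ) (by simp [hφ])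
  have hχc : HasCompactSupport (fun x => χ (v x)) := hc.comp_left (g := χ) χz
  have hχi : Integrable (fun x => χ (v x)) :=
    (hχ.comp hv.continuous).integrable_of_hasCompactSupport hχc
  have hfc : Continuous (fderiv ℝ v) := hv1.continuous_fderiv one_ne_zero
  have hn : ∀ x, ‖fderiv ℝ (fun x => φ (v x)) x‖ = χ (v x) * ‖fderiv ℝ v x‖ := by
    intro x
    have h2 : HasFDerivAt (fun x => φ (v x)) (χ (v x) • fderiv ℝ v x) x :=
      (hd (v x)).comp_hasFDerivAt x (hv1.differentiable (by simp) x).hasFDerivAt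
    rw [h2.fderiv, norm_smul, Real.norm_of_nonneg (χ0 _)]
  have iso := iso_ineq _ hu huc
  simp only [hn] at iso
  have hcv := hv.continuous
  have cs := cs_int (μ := (volume : Measure E2)) (fun x => χ (v x)) (fun x => χ (v x) * ‖fderiv ℝ v x‖)
    (fun x => χ (v x) * ‖fderiv ℝ v x‖ ^ 2) hχi
    (Continuous.integrable_of_hasCompactSupport (by fun_prop) hχc.mul_right)
    (Continuous.integrable_of_hasCompactSupport (by fun_prop) hχc.mul_right)
    (fun x => χ0 _) (fun x => mul_nonneg (χ0 _) (sq_nonneg _))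
    (fun x => le_of_eq (by ring))
  rw [coarea_D v hv hc χ hχ] at cs
  refine le_trans ?_ (iso.trans cs)
  have hms : MeasurableSet {x | a ≤ v x} := (isClosed_le continuous_const hcv).measurableSet
  have h2 : Integrable (fun x => φ (v x) ^ 2) := by
    refine Continuous.integrable_of_hasCompactSupport (hu.continuous.pow 2) ?_
    simp only [sq]
    exact huc.mul_right
  refine mul_le_mul_of_nonneg_left ?_ (by positivity)
  calc φ a ^ 2 * volume.real {x | a ≤ v x} = ∫ x in {x | a ≤ v x}, φ a ^ 2 := by
        rw [setIntegral_const, smul_eq_mul, mul_comm]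
    _ ≤ ∫ x in {x | a ≤ v x}, φ (v x) ^ 2 := by
        have hfin : volume {x | a ≤ v x} < ⊤ := by
          refine lt_of_le_of_lt (measure_mono ?_) hc.isCompact.measure_lt_top
          intro x hx
          apply subset_tsupport
          have : a ≤ v x := hx
          simp only [Function.mem_support]; linarith
        refine setIntegral_mono_on (integrableOn_const hfin.ne) h2.integrableOn hms ?_
        intro x hx
        have hm : Monotone φ := monotone_of_deriv_nonneg (fun t => (hd t).differentiableAt)
          (fun t => by rw [(hd t).deriv]; exact χ0 t)
        have h0 : φ 0 = 0 := by simp [hφ]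
        have h1 : 0 ≤ φ a := by rw [← h0]; exact hm ha.le
        exact pow_le_pow_left₀ h1 (hm hx) 2
    _ ≤ ∫ x, φ (v x) ^ 2 := setIntegral_le_integral h2 (Filter.Eventually.of_forall fun x => sq_nonneg _)

theorem vol_fin (v : E2 → ℝ) (hc : HasCompactSupport v) (a : ℝ) (ha : 0 < a) (s : Set E2)
    (hs : ∀ x ∈ s, a ≤ v x) : volume s < ⊤ := by
  refine lt_of_le_of_lt (measure_mono ?_) hc.isCompact.measure_lt_top
  intro x hx
  apply subset_tsupport
  have : a ≤ v x := hs x hx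
  simp only [Function.mem_support]; linarith

theorem window_ineq (v : E2 → ℝ) (hv : ContDiff ℝ 2 v) (hc : HasCompactSupport v)
    (t h : ℝ) (hh : 0 < h) (ht : h < t) :
    4 * π * ((2 * h) ^ 2 * volume.real {x | t + h ≤ v x})
      ≤ volume.real {x | |v x - t| ≤ h} * ∫ s in (t - h)..(t + h), fluxD v s := by
  have hD := fluxD_continuous v hv hc
  have hcv := hv.continuous
  have key : ∀ δ : ℝ, 0 < δ → δ < h → 4 * π * ((2 * h - 2 * δ) ^ 2 * volume.real {x | t + h ≤ v x})
      ≤ volume.real {x | |v x - t| ≤ h} * ∫ s in (t - h)..(t + h), fluxD v s := by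
    intro δ hδ hδh
    set χ : ℝ → ℝ := fun s => min 1 (max 0 ((h - |s - t|) / δ)) with hχd
    have hχ : Continuous χ := by fun_prop
    have χ0 : ∀ s, 0 ≤ χ s := fun s => le_min zero_le_one (le_max_left _ _)
    have χ1 : ∀ s, χ s ≤ 1 := fun s => min_le_left _ _
    have χout : ∀ s, h ≤ |s - t| → χ s = 0 := by
      intro s hs
      have : (h - |s - t|) / δ ≤ 0 := div_nonpos_of_nonpos_of_nonneg (by linarith) hδ.le
      simp only [hχd]
      rw [max_eq_left this, min_eq_right zero_le_one]
    have χin : ∀ s, |s - t| ≤ h - δ → χ s = 1 := by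
      intro s hs
      have : 1 ≤ (h - |s - t|) / δ := by rw [le_div_iff₀ hδ]; linarith
      simp only [hχd]
      rw [min_eq_left (this.trans (le_max_right _ _))]
    have χz : χ 0 = 0 := χout 0 (by rw [zero_sub, abs_neg, abs_of_pos (by linarith)]; exact ht.le)
    have L := level_ineq v hv hc χ hχ χ0 χz (t + h) (by linarith)
    have b1 : 2 * h - 2 * δ ≤ ∫ s in (0:ℝ)..(t + h), χ s := by
      have e : ∫ s in (t - h + δ)..(t + h - δ), χ s = 2 * h - 2 * δ := by
        have : ∫ s in (t - h + δ)..(t + h - δ), χ s = ∫ s in (t - h + δ)..(t + h - δ), (1:ℝ) := by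
          apply intervalIntegral.integral_congr
          intro s hs
          rw [Set.uIcc_of_le (by linarith)] at hs
          exact χin s (abs_le.2 ⟨by linarith [hs.1], by linarith [hs.2]⟩)
        rw [this, intervalIntegral.integral_const]; simp; ring
      rw [← e]
      apply intervalIntegral.integral_mono_interval (by linarith) (by linarith) (by linarith)
      · exact Filter.Eventually.of_forall χ0
      · exact hχ.intervalIntegrable _ _
    have b2 : ∫ x, χ (v x) ≤ volume.real {x | |v x - t| ≤ h} := by
      have hms : MeasurableSet {x | |v x - t| ≤ h} :=
        (isClosed_le (by fun_prop) continuous_const).measurableSet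
      have hfin : volume {x | |v x - t| ≤ h} < ⊤ := by
        apply vol_fin v hc (t - h) (by linarith)
        intro x hx
        have hx' : |v x - t| ≤ h := hx
        have := (abs_le.1 hx').1
        linarith
      rw [← integral_indicator_one hms]
      apply integral_mono_of_nonneg (Filter.Eventually.of_forall fun x => χ0 _)
      · exact (integrable_indicator_iff hms).2 (integrableOn_const hfin.ne)
      · refine Filter.Eventually.of_forall fun x => ?_
        by_cases hx : |v x - t| ≤ h
        · simp only [Set.indicator_apply, Set.mem_ofPred_eq, hx, if_true]; exact χ1 _
        · simp only [Set.indicator_apply, Set.mem_ofPred_eq, hx, if_false]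
          exact (χout _ (not_le.1 hx).le).le
    have b3 : ∫ s, χ s * fluxD v s ≤ ∫ s in (t - h)..(t + h), fluxD v s := by
      rw [intervalIntegral.integral_of_le (by linarith), ← integral_indicator measurableSet_Ioc]
      apply integral_mono_of_nonneg
        (Filter.Eventually.of_forall fun x => mul_nonneg (χ0 _) (fluxD_nonneg v hv hc _))
      · exact (integrable_indicator_iff measurableSet_Ioc).2
          (hD.integrableOn_Icc.mono_set Set.Ioc_subset_Icc_self)
      · refine Filter.Eventually.of_forall fun s => ?_
        have hDs := fluxD_nonneg v hv hc s
        by_cases hs : s ∈ Set.Ioc (t - h) (t + h)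
        · simp only [Set.indicator_apply, hs, if_true]
          exact mul_le_of_le_one_left hDs (χ1 s)
        · simp only [Set.indicator_apply, hs, if_false]
          rw [χout s, zero_mul]
          by_contra hcon
          have := abs_lt.1 (not_le.1 hcon)
          exact hs ⟨by linarith [this.1], by linarith [this.2]⟩
    have b4 : 0 ≤ ∫ s, χ s * fluxD v s :=
      integral_nonneg fun x => mul_nonneg (χ0 _) (fluxD_nonneg v hv hc _)
    refine le_trans ?_ (L.trans (mul_le_mul b2 b3 b4 measureReal_nonneg))
    have := pow_le_pow_left₀ (by linarith) b1 2
    gcongr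
  have hlim : Filter.Tendsto (fun δ : ℝ => 4 * π * ((2 * h - 2 * δ) ^ 2 * volume.real {x | t + h ≤ v x}))
      (nhdsWithin 0 (Set.Ioi 0)) (nhds (4 * π * ((2 * h - 2 * 0) ^ 2 * volume.real {x | t + h ≤ v x}))) := by
    apply Filter.Tendsto.mono_left _ nhdsWithin_le_nhds
    apply Continuous.tendsto
    fun_prop
  rw [mul_zero, sub_zero] at hlim
  refine le_of_tendsto hlim ?_
  filter_upwards [Ioo_mem_nhdsGT hh] with δ hδ using key δ hδ.1 hδ.2

end PartB2

section PartB3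
local notation "E2" => EuclideanSpace ℝ (Fin 2)

theorem rn_step (v : E2 → ℝ) (hv : ContDiff ℝ 2 v) (hc : HasCompactSupport v)
    (ν : Measure ℝ) (hν : ν = Measure.map v (volume.restrict {x | 0 < v x})) (t h t' d : ℝ)
    (hh : 0 < h) (ht : h < t) (ht' : t + h ≤ t') (hd : ∀ s ∈ Set.Icc (t - h) (t + h), fluxD v s ≤ d)
    (d0 : 0 ≤ d) :
    ENNReal.ofReal (4 * π) * volume {x | t' ≤ v x} ≤
      (ν (Metric.closedBall t h) / volume (Metric.closedBall t h)) * ENNReal.ofReal d := by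
  have hD := fluxD_continuous v hv hc
  have hcv := hv.continuous
  have w := window_ineq v hv hc t h hh ht
  have e1 : ν (Metric.closedBall t h) = volume {x | |v x - t| ≤ h} := by
    rw [hν, Measure.map_apply hcv.measurable Metric.isClosed_closedBall.measurableSet,
      Measure.restrict_apply (hcv.measurable Metric.isClosed_closedBall.measurableSet)]
    congr 1; ext x
    simp only [Set.mem_inter_iff, Set.mem_preimage, Metric.mem_closedBall, Real.dist_eq, Set.mem_ofPred_eq]
    constructor
    · exact fun h => h.1
    · intro h1; exact ⟨h1, by linarith [(abs_le.1 h1).1]⟩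
  have f1 : volume {x | |v x - t| ≤ h} < ⊤ := by
    apply vol_fin v hc (t - h) (by linarith)
    intro x hx
    have hx' : |v x - t| ≤ h := hx
    linarith [(abs_le.1 hx').1]
  have f2 : volume {x | t + h ≤ v x} < ⊤ := vol_fin v hc (t + h) (by linarith) _ fun x hx => hx
  have b : ∫ s in (t - h)..(t + h), fluxD v s ≤ 2 * h * d := by
    calc ∫ s in (t - h)..(t + h), fluxD v s ≤ ∫ s in (t - h)..(t + h), d :=
          intervalIntegral.integral_mono_on (by linarith) (hD.intervalIntegrable _ _)
            (by simp) hd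
      _ = 2 * h * d := by rw [intervalIntegral.integral_const, smul_eq_mul]; ring
  have k : 4 * π * volume.real {x | t + h ≤ v x} ≤ volume.real {x | |v x - t| ≤ h} / (2 * h) * d := by
    have h1 := w.trans (mul_le_mul_of_nonneg_left b measureReal_nonneg)
    rw [div_mul_eq_mul_div, le_div_iff₀ (by linarith)]
    have h2 : 0 < 2 * h := by linarith
    have h3 : (4 * π * volume.real {x | t + h ≤ v x} * (2 * h)) * (2 * h)
      ≤ (volume.real {x | |v x - t| ≤ h} * d) * (2 * h) := by nlinarith
    exact le_of_mul_le_mul_right h3 h2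
  have m1 : volume {x | t' ≤ v x} ≤ volume {x | t + h ≤ v x} :=
    measure_mono fun x hx => ht'.trans hx
  calc ENNReal.ofReal (4 * π) * volume {x | t' ≤ v x}
      ≤ ENNReal.ofReal (4 * π) * volume {x | t + h ≤ v x} := by gcongr
    _ = ENNReal.ofReal (4 * π * volume.real {x | t + h ≤ v x}) := by
        rw [ENNReal.ofReal_mul (p := 4 * π) (by positivity), ofReal_measureReal f2.ne]
    _ ≤ ENNReal.ofReal (volume.real {x | |v x - t| ≤ h} / (2 * h) * d) := ENNReal.ofReal_le_ofReal k
    _ = _ := by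
        rw [ENNReal.ofReal_mul (by positivity), ENNReal.ofReal_div_of_pos (by linarith),
          ofReal_measureReal f1.ne, e1, Real.volume_closedBall]

theorem rn_ineq (v : E2 → ℝ) (hv : ContDiff ℝ 2 v) (hc : HasCompactSupport v)
    (ν : Measure ℝ) (hν : ν = Measure.map v (volume.restrict {x | 0 < v x})) [IsFiniteMeasure ν] :
    ∀ᵐ t : ℝ, 0 < t → ENNReal.ofReal (4 * π) * volume {x | t ≤ v x} ≤
      ν.rnDeriv volume t * ENNReal.ofReal (fluxD v t) := by
  have hD := fluxD_continuous v hv hc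
  have hcv := hv.continuous
  have hcount := (Measure.countable_meas_level_set_pos (μ := (volume : Measure E2)) hcv.measurable).ae_notMem
    (volume : Measure ℝ)
  filter_upwards [Besicovitch.ae_tendsto_rnDeriv ν volume, Measure.rnDeriv_lt_top ν volume, hcount]
    with t h1 h2 h3 ht
  have h3' : volume {x | v x = t} = 0 := by
    simpa using h3
  have s1 : ∀ t', t < t' → ∀ ε : ℝ, 0 < ε → ENNReal.ofReal (4 * π) * volume {x | t' ≤ v x} ≤
      ν.rnDeriv volume t * ENNReal.ofReal (fluxD v t + ε) := by
    intro t' ht' ε hε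
    have hd0 : 0 ≤ fluxD v t + ε := by linarith [fluxD_nonneg v hv hc t]
    refine ge_of_tendsto (ENNReal.Tendsto.mul_const h1 (Or.inr ENNReal.ofReal_ne_top)) ?_
    have hev : ∀ᶠ s in nhds t, fluxD v s < fluxD v t + ε :=
      hD.continuousAt.eventually_lt continuousAt_const (by linarith)
    obtain ⟨r, hr, hr2⟩ := Metric.eventually_nhds_iff.1 hev
    have hpos : 0 < min (min r t) (t' - t) := by
      apply lt_min (lt_min hr ht); linarith
    filter_upwards [Ioo_mem_nhdsGT hpos] with h hh
    have a1 := hh.2.trans_le (min_le_left _ _)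
    have a2 := hh.2.trans_le (min_le_right _ _)
    have a3 := a1.trans_le (min_le_left _ _)
    have a4 := a1.trans_le (min_le_right _ _)
    apply rn_step v hv hc ν hν t h t' _ hh.1 a4 (by linarith) _ hd0
    intro s hs
    apply (hr2 _).le
    rw [Real.dist_eq]
    exact lt_of_le_of_lt (abs_le.2 ⟨by linarith [hs.1], by linarith [hs.2]⟩) a3
  have s2 : ∀ t', t < t' → ENNReal.ofReal (4 * π) * volume {x | t' ≤ v x} ≤
      ν.rnDeriv volume t * ENNReal.ofReal (fluxD v t) := by
    intro t' ht'
    have hlim : Filter.Tendsto (fun ε : ℝ => ν.rnDeriv volume t * ENNReal.ofReal (fluxD v t + ε))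
        (nhdsWithin 0 (Set.Ioi 0)) (nhds (ν.rnDeriv volume t * ENNReal.ofReal (fluxD v t + 0))) := by
      refine ENNReal.Tendsto.const_mul ?_ (Or.inr h2.ne)
      apply Filter.Tendsto.mono_left _ nhdsWithin_le_nhds
      exact (ENNReal.continuous_ofReal.comp (continuous_const.add continuous_id)).tendsto 0
    rw [add_zero] at hlim
    refine ge_of_tendsto hlim ?_
    filter_upwards [self_mem_nhdsWithin] with ε hε using s1 t' ht' ε hε
  have e1 : volume {x | t ≤ v x} ≤ volume {x | t < v x} := by
    have : {x | t ≤ v x} ⊆ {x | t < v x} ∪ {x | v x = t} := by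
      intro x hx
      rcases lt_or_eq_of_le (show t ≤ v x from hx) with h | h
      · exact Or.inl h
      · exact Or.inr h.symm
    refine (measure_mono this).trans ((measure_union_le _ _).trans ?_)
    rw [h3', add_zero]
  have e2 : {x | t < v x} = ⋃ n : ℕ, {x | t + 1 / ((n:ℝ) + 1) ≤ v x} := by
    ext x
    simp only [Set.mem_ofPred_eq, Set.mem_iUnion]
    constructor
    · intro h
      obtain ⟨n, hn⟩ := exists_nat_one_div_lt (sub_pos.2 h)
      exact ⟨n, by linarith⟩
    · rintro ⟨n, hn⟩
      have : 0 < 1 / ((n:ℝ) + 1) := by positivity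
      linarith
  have e3 : volume {x | t < v x} = ⨆ n : ℕ, volume {x | t + 1 / ((n:ℝ) + 1) ≤ v x} := by
    rw [e2]
    apply Monotone.measure_iUnion
    intro n m hnm x hx
    have : 1 / ((m:ℝ) + 1) ≤ 1 / ((n:ℝ) + 1) := by
      apply one_div_le_one_div_of_le (by positivity)
      have : (n:ℝ) ≤ m := by exact_mod_cast hnm
      linarith
    have hx' : t + 1 / ((n:ℝ) + 1) ≤ v x := hx
    show t + 1 / ((m:ℝ) + 1) ≤ v x
    linarith
  calc ENNReal.ofReal (4 * π) * volume {x | t ≤ v x} ≤ ENNReal.ofReal (4 * π) * volume {x | t < v x} := by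
        gcongr
    _ ≤ _ := by
        rw [e3, ENNReal.mul_iSup]
        apply iSup_le
        intro n
        apply s2
        have : 0 < 1 / ((n:ℝ) + 1) := by positivity
        linarith

theorem weighted_ineq (v : E2 → ℝ) (hv : ContDiff ℝ 2 v) (hc : HasCompactSupport v)
    (G : ℝ → ENNReal) (hG : Measurable G) :
    ∫⁻ t in Set.Ioi (0:ℝ), ENNReal.ofReal (4 * π) * volume {x | t ≤ v x} * G t
      ≤ ∫⁻ x in {x | 0 < v x}, ENNReal.ofReal (fluxD v (v x)) * G (v x) := by
  have hD := fluxD_continuous v hv hc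
  have hcv := hv.continuous
  have hfin : volume {x | 0 < v x} < ⊤ := by
    refine lt_of_le_of_lt (measure_mono ?_) hc.isCompact.measure_lt_top
    intro x hx
    exact subset_tsupport _ (ne_of_gt hx)
  set ν := Measure.map v (volume.restrict {x | 0 < v x}) with hν
  have : IsFiniteMeasure (volume.restrict {x : E2 | 0 < v x}) := ⟨by simpa using hfin⟩
  have : IsFiniteMeasure ν := by rw [hν]; infer_instance
  have hH : Measurable (fun t => ENNReal.ofReal (fluxD v t) * G t) :=
    (ENNReal.measurable_ofReal.comp hD.measurable).mul hG
  calc ∫⁻ t in Set.Ioi (0:ℝ), ENNReal.ofReal (4 * π) * volume {x | t ≤ v x} * G t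
      ≤ ∫⁻ t in Set.Ioi (0:ℝ), ν.rnDeriv volume t * (ENNReal.ofReal (fluxD v t) * G t) := by
        apply lintegral_mono_ae
        refine (ae_restrict_iff' measurableSet_Ioi).2 ?_
        filter_upwards [rn_ineq v hv hc ν hν] with t ht ht0
        rw [← mul_assoc]
        exact mul_le_mul_left (ht ht0) _
    _ ≤ ∫⁻ t, ν.rnDeriv volume t * (ENNReal.ofReal (fluxD v t) * G t) := setLIntegral_le_lintegral _ _
    _ = ∫⁻ t, (ENNReal.ofReal (fluxD v t) * G t) ∂(volume.withDensity (ν.rnDeriv volume)) := by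
        rw [lintegral_withDensity_eq_lintegral_mul _ (Measure.measurable_rnDeriv _ _) hH]
        rfl
    _ ≤ ∫⁻ t, (ENNReal.ofReal (fluxD v t) * G t) ∂ν :=
        lintegral_mono' (Measure.withDensity_rnDeriv_le _ _) le_rfl
    _ = _ := by rw [hν, lintegral_map hH hcv.measurable]

end PartB3

section PartB4
local notation "E2" => EuclideanSpace ℝ (Fin 2)

theorem laplacian_sq_integrable (v : E2 → ℝ) (hv : ContDiff ℝ 2 v) (hc : HasCompactSupport v) :
    Integrable (fun x => laplacian v x ^ 2) := by
  refine ((laplacian_continuous v hv).pow 2).integrable_of_hasCompactSupport ?_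
  simp only [sq]
  exact (laplacian_supp v hc).mul_right

theorem fluxD_sq_le (v : E2 → ℝ) (hv : ContDiff ℝ 2 v) (hc : HasCompactSupport v) (t : ℝ) (ht : 0 < t) :
    fluxD v t ^ 2 ≤ volume.real {x | t ≤ v x} * ∫ x, laplacian v x ^ 2 := by
  have f1 : volume {x | t ≤ v x} < ⊤ := vol_fin v hc t ht _ fun x hx => hx
  have sub : {x | t < v x} ⊆ {x | t ≤ v x} := fun x hx => le_of_lt (show t < v x from hx)
  have f2 : volume {x | t < v x} < ⊤ := lt_of_le_of_lt (measure_mono sub) f1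
  have hsq := laplacian_sq_integrable v hv hc
  have := cs_int (μ := volume.restrict {x | t < v x}) (fun _ => 1) (fun x => - laplacian v x)
    (fun x => laplacian v x ^ 2) (integrableOn_const f2.ne) (laplacian_integrable v hv hc).neg.integrableOn
    hsq.integrableOn (fun _ => zero_le_one) (fun _ => sq_nonneg _)
    (fun x => by rw [neg_sq, one_mul])
  refine this.trans ?_
  apply mul_le_mul
  · rw [setIntegral_const, smul_eq_mul, mul_one]
    exact measureReal_mono sub f1.ne
  · exact setIntegral_le_integral hsq (Filter.Eventually.of_forall fun x => sq_nonneg _)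
  · exact integral_nonneg fun x => sq_nonneg _
  · exact measureReal_nonneg

theorem pos_fin (v : E2 → ℝ) (hc : HasCompactSupport v) : volume {x | 0 < v x} < ⊤ := by
  refine lt_of_le_of_lt (measure_mono ?_) hc.isCompact.measure_lt_top
  intro x hx
  exact subset_tsupport _ (ne_of_gt hx)

theorem fluxD_comp_integrableOn (v : E2 → ℝ) (hv : ContDiff ℝ 2 v) (hc : HasCompactSupport v)
    (s : Set E2) (hs : volume s < ⊤) : IntegrableOn (fun x => fluxD v (v x)) s := by
  have hD := fluxD_continuous v hv hc
  obtain ⟨C, hC⟩ := (fluxD_supp v hv hc).exists_bound_of_continuous hD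
  refine Measure.integrableOn_of_bounded hs.ne (hD.comp hv.continuous).aestronglyMeasurable (M := C) ?_
  exact Filter.Eventually.of_forall fun x => hC _

theorem ineq_i (v : E2 → ℝ) (hv : ContDiff ℝ 2 v) (hc : HasCompactSupport v) :
    4 * π * ∫ x, v x ≤ ∫ x in {x | 0 < v x}, fluxD v (v x) := by
  have hcv := hv.continuous
  have hvi : Integrable v := hcv.integrable_of_hasCompactSupport hc
  have hpi : Integrable (fun x => max (v x) 0) := hvi.pos_part
  have w := weighted_ineq v hv hc (fun _ => 1) measurable_const
  simp only [mul_one] at w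
  rw [← ofReal_integral_eq_lintegral_ofReal (fluxD_comp_integrableOn v hv hc _ (pos_fin v hc))
    (Filter.Eventually.of_forall fun x => fluxD_nonneg v hv hc _)] at w
  rw [lintegral_const_mul' _ _ ENNReal.ofReal_ne_top] at w
  have e : ∫⁻ t in Set.Ioi (0:ℝ), volume {x | t ≤ v x} = ∫⁻ x, ENNReal.ofReal (max (v x) 0) := by
    rw [lintegral_eq_lintegral_meas_le (f := fun x => max (v x) 0) _ (Filter.Eventually.of_forall fun x => le_max_right _ _)
      hpi.aemeasurable]
    apply setLIntegral_congr_fun measurableSet_Ioi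
    intro t ht
    have ht' : 0 < t := ht
    simp only
    congr 1; ext x
    simp [not_le.2 ht']
  rw [e, ← ofReal_integral_eq_lintegral_ofReal hpi (Filter.Eventually.of_forall fun x => le_max_right _ _),
    ← ENNReal.ofReal_mul (by positivity), ENNReal.ofReal_le_ofReal_iff] at w
  · refine le_trans ?_ w
    refine mul_le_mul_of_nonneg_left ?_ (by positivity)
    exact integral_mono hvi hpi fun x => le_max_left _ _
  · exact integral_nonneg fun x => fluxD_nonneg v hv hc _

theorem meas_distr (v : E2 → ℝ) : Measurable (fun t => volume.real {x | t ≤ v x}) := by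
  have : Antitone (fun t => volume {x | t ≤ v x}) := fun s t hst =>
    measure_mono fun x hx => hst.trans hx
  exact this.measurable.ennreal_toReal

theorem ratio_integrableOn (v : E2 → ℝ) (hv : ContDiff ℝ 2 v) (hc : HasCompactSupport v) :
    IntegrableOn (fun x => fluxD v (v x) ^ 2 / volume.real {y | v x ≤ v y}) {x | 0 < v x} := by
  have hD := fluxD_continuous v hv hc
  have hms : MeasurableSet {x | 0 < v x} := meas_lt v hv 0
  refine Measure.integrableOn_of_bounded (pos_fin v hc).ne ?_ (M := ∫ x, laplacian v x ^ 2) ?_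
  · have h1 := (meas_distr v).comp hv.continuous.measurable
    exact (((hD.comp hv.continuous).measurable.pow_const 2).div h1).aestronglyMeasurable
  · refine (ae_restrict_iff' hms).2 (Filter.Eventually.of_forall fun x hx => ?_)
    rw [Real.norm_of_nonneg (by positivity)]
    apply div_le_of_le_mul₀ measureReal_nonneg (integral_nonneg fun x => sq_nonneg _)
    rw [mul_comm]
    exact fluxD_sq_le v hv hc (v x) hx

theorem ineq_ii (v : E2 → ℝ) (hv : ContDiff ℝ 2 v) (hc : HasCompactSupport v) :
    4 * π * ∫ t in Set.Ioi (0:ℝ), fluxD v t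
      ≤ ∫ x in {x | 0 < v x}, fluxD v (v x) ^ 2 / volume.real {y | v x ≤ v y} := by
  have hcv := hv.continuous
  have hD := fluxD_continuous v hv hc
  have hDi : Integrable (fluxD v) := hD.integrable_of_hasCompactSupport (fluxD_supp v hv hc)
  have w := weighted_ineq v hv hc (fun t => ENNReal.ofReal (fluxD v t / volume.real {x | t ≤ v x}))
    (ENNReal.measurable_ofReal.comp (hD.measurable.div (meas_distr v)))
  have e1 : ∫⁻ t in Set.Ioi (0:ℝ), ENNReal.ofReal (4 * π) * volume {x | t ≤ v x} *
      ENNReal.ofReal (fluxD v t / volume.real {x | t ≤ v x})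
      = ∫⁻ t in Set.Ioi (0:ℝ), ENNReal.ofReal (4 * π * fluxD v t) := by
    apply setLIntegral_congr_fun measurableSet_Ioi
    intro t ht
    have ht' : 0 < t := ht
    have f1 : volume {x | t ≤ v x} < ⊤ := vol_fin v hc t ht _ fun x hx => hx
    simp only
    rw [← ofReal_measureReal f1.ne, ← ENNReal.ofReal_mul (by positivity), ← ENNReal.ofReal_mul (by positivity)]
    congr 1
    have hsq := fluxD_sq_le v hv hc t ht
    by_cases h0 : volume.real {x | t ≤ v x} = 0
    · rw [h0, zero_mul] at hsq
      have : fluxD v t = 0 := by nlinarith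
      rw [this]; simp
    · field_simp
  have e2 : ∀ x, ENNReal.ofReal (fluxD v (v x)) * ENNReal.ofReal (fluxD v (v x) / volume.real {y | v x ≤ v y})
      = ENNReal.ofReal (fluxD v (v x) ^ 2 / volume.real {y | v x ≤ v y}) := by
    intro x
    rw [← ENNReal.ofReal_mul (fluxD_nonneg v hv hc _)]
    congr 1; ring
  simp only [e2] at w
  rw [e1, ← ofReal_integral_eq_lintegral_ofReal (hDi.const_mul _).integrableOn
    (Filter.Eventually.of_forall fun x => mul_nonneg (by positivity) (fluxD_nonneg v hv hc _)),
    ← ofReal_integral_eq_lintegral_ofReal (ratio_integrableOn v hv hc)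
    (Filter.Eventually.of_forall fun x => by positivity), ENNReal.ofReal_le_ofReal_iff,
    integral_const_mul] at w
  · exact w
  · exact integral_nonneg fun x => by positivity

theorem laplacian_neg (v : E2 → ℝ) (x : E2) : laplacian (fun x => - v x) x = - laplacian v x := by
  unfold laplacian
  have : ∀ e : E2, (fun y => fderiv ℝ (fun x => - v x) y e) = fun y => - fderiv ℝ v y e := by
    intro e; ext y
    rw [fderiv_fun_neg]; rfl
  rw [← Finset.sum_neg_distrib]
  refine Finset.sum_congr rfl fun i _ => ?_
  rw [this, fderiv_fun_neg]
  rfl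

theorem fluxD_neg (v : E2 → ℝ) (hv : ContDiff ℝ 2 v) (hc : HasCompactSupport v) (t : ℝ) :
    fluxD (fun x => - v x) t = fluxD v (- t) := by
  have hi := laplacian_integrable v hv hc
  have h0 := integral_laplacian v hv hc
  have hin : Integrable (fun x => - laplacian v x) := hi.neg
  have ms := meas_lt v hv (-t)
  rw [← integral_add_compl ms hin] at h0
  have e : ∫ x in {x | -t < v x}ᶜ, - laplacian v x = ∫ x in {x | t < - v x}, - laplacian v x := by
    have m2 : MeasurableSet {x | t < - v x} := (isOpen_lt continuous_const hv.continuous.neg).measurableSet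
    rw [← integral_indicator ms.compl, ← integral_indicator m2]
    apply integral_congr_ae
    filter_upwards [laplacian_level v hv (-t)] with x hx
    simp only [Set.indicator_apply, Set.mem_compl_iff, Set.mem_ofPred_eq]
    rcases lt_trichotomy (v x) (-t) with h | h | h
    · have h1 : t < - v x := by linarith
      have h2 : ¬ (-t < v x) := by linarith
      simp [h1, h2]
    · simp [hx h]
    · have h1 : ¬ t < - v x := by linarith
      simp [h, h1]
  unfold fluxD
  simp only [laplacian_neg]
  rw [integral_neg, ← e]
  have h0' : ∫ x in {x | -t < v x}, -laplacian v x + 0 = - ∫ x in {x | -t < v x}ᶜ, - laplacian v x := by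
    simp only [add_zero]
    exact eq_neg_of_add_eq_zero_left h0
  simpa using h0'.symm

theorem ineq_iii (v : E2 → ℝ) (hv : ContDiff ℝ 2 v) (hc : HasCompactSupport v) :
    4 * π * ∫ t in Set.Iic (0:ℝ), fluxD v t
      ≤ ∫ x in {x | v x < 0}, fluxD v (v x) ^ 2 / volume.real {y | v y ≤ v x} := by
  have h := ineq_ii (fun x => - v x) hv.neg hc.neg
  have e1 : ∫ t in Set.Ioi (0:ℝ), fluxD (fun x => - v x) t = ∫ t in Set.Iic (0:ℝ), fluxD v t := by
    simp only [fluxD_neg v hv hc]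
    rw [integral_comp_neg_Ioi, neg_zero]
  rw [e1] at h
  simpa [fluxD_neg v hv hc] using h

theorem ratio_neg_integrableOn (v : E2 → ℝ) (hv : ContDiff ℝ 2 v) (hc : HasCompactSupport v) :
    IntegrableOn (fun x => fluxD v (v x) ^ 2 / volume.real {y | v y ≤ v x}) {x | v x < 0} := by
  have h := ratio_integrableOn (fun x => - v x) hv.neg hc.neg
  simpa [fluxD_neg v hv hc] using h

/-- The upper bound for the Dirichlet integral. -/
theorem dirichlet_bound (v : E2 → ℝ) (hv : ContDiff ℝ 2 v) (hc : HasCompactSupport v) :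
    4 * π * ∫ x, ‖fderiv ℝ v x‖ ^ 2
      ≤ (∫ x in {x | 0 < v x}, fluxD v (v x) ^ 2 / volume.real {y | v x ≤ v y})
        + ∫ x in {x | v x < 0}, fluxD v (v x) ^ 2 / volume.real {y | v y ≤ v x} := by
  have hD := fluxD_continuous v hv hc
  have hDi : Integrable (fluxD v) := hD.integrable_of_hasCompactSupport (fluxD_supp v hv hc)
  rw [dirichlet_D v hv hc, ← integral_add_compl measurableSet_Ioi hDi (s := Set.Ioi (0:ℝ)), mul_add,
    Set.compl_Ioi]
  exact add_le_add (ineq_ii v hv hc) (ineq_iii v hv hc)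

end PartB4

section PartC

/-- continuity of `t ↦ ∫_{N < t} g` if `g` vanishes a.e. on levels of `N` -/
theorem cont_sublevel {α : Type*} [MeasurableSpace α] {μ : Measure α} (N : α → ℝ) (hN : Measurable N)
    (g : α → ℝ) (hg : Integrable g μ) (hl : ∀ c, ∀ᵐ x ∂μ, N x = c → g x = 0) :
    Continuous (fun t => ∫ x in {x | N x < t}, g x ∂μ) := by
  rw [continuous_iff_continuousAt]
  intro t0
  have ms : ∀ t, MeasurableSet {x | N x < t} := fun t => measurableSet_lt hN measurable_const
  have e1 : (fun t => ∫ x in {x | N x < t}, g x ∂μ) = fun t => ∫ x, ({x | N x < t}).indicator g x ∂μ := by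
    ext t
    rw [integral_indicator (ms t)]
  rw [e1]
  apply continuousAt_of_dominated (bound := fun x => ‖g x‖)
  · exact Filter.Eventually.of_forall fun t => (hg.indicator (ms t)).aestronglyMeasurable
  · exact Filter.Eventually.of_forall fun t => Filter.Eventually.of_forall fun x =>
      norm_indicator_le_norm_self _ _
  · exact hg.norm
  · filter_upwards [hl t0] with x hx
    by_cases h : N x = t0
    · have : (fun t => ({x | N x < t}).indicator g x) = fun t => 0 := by
        ext t
        simp [Set.indicator_apply, hx h]
      rw [this]; exact continuousAt_const
    · rcases lt_or_gt_of_ne h with h1 | h1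
      · have : (fun t => ({x | N x < t}).indicator g x) =ᶠ[nhds t0] fun t => g x := by
          filter_upwards [lt_mem_nhds h1] with t ht
          have ht' : N x < t := ht
          simp [ht']
        exact continuousAt_const.congr this.symm
      · have : (fun t => ({x | N x < t}).indicator g x) =ᶠ[nhds t0] fun t => 0 := by
          filter_upwards [gt_mem_nhds h1] with t ht
          simp [not_lt.2 (le_of_lt ht)]
        exact continuousAt_const.congr this.symm

theorem exists_cdf_eq {α : Type*} [MeasurableSpace α] (μ : Measure α) [IsFiniteMeasure μ] (N : α → ℝ)
    (hN : Measurable N) (hl : ∀ c, μ {x | N x = c} = 0) (s : ℝ) (hs : 0 < s) (hs2 : s < μ.real Set.univ) :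
    ∃ t, μ.real {x | N x < t} = s := by
  have hc : Continuous (fun t => μ.real {x | N x < t}) := by
    have := cont_sublevel (μ := μ) N hN (fun _ => 1) (integrable_const 1) (fun c => by
      have h := hl c
      filter_upwards [measure_eq_zero_iff_ae_notMem.1 h] with x hx h2
      exact absurd h2 hx)
    simpa using this
  have hmono : Monotone (fun t => {x | N x < t}) := fun a b hab x hx => lt_of_lt_of_le hx hab
  have t1 : Filter.Tendsto (fun t => μ {x | N x < t}) Filter.atTop (nhds (μ (⋃ t, {x | N x < t}))) :=
    tendsto_measure_iUnion_atTop hmono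
  have u1 : (⋃ t, {x | N x < t}) = Set.univ := by
    ext x; simp only [Set.mem_iUnion, Set.mem_ofPred_eq, Set.mem_univ, iff_true]; exact ⟨N x + 1, by linarith⟩
  have t2 : Filter.Tendsto (fun t => μ {x | N x < t}) Filter.atBot (nhds (μ (⋂ t, {x | N x < t}))) := by
    apply tendsto_measure_iInter_atBot (fun t => (measurableSet_lt hN measurable_const).nullMeasurableSet) hmono
    exact ⟨0, measure_ne_top _ _⟩
  have u2 : (⋂ t, {x | N x < t}) = ∅ := by
    ext x; simp only [Set.mem_iInter, Set.mem_ofPred_eq, Set.mem_empty_iff_false, iff_false, not_forall]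
    exact ⟨N x, lt_irrefl _⟩
  rw [u1] at t1
  rw [u2, measure_empty] at t2
  have t1' : Filter.Tendsto (fun t => μ.real {x | N x < t}) Filter.atTop (nhds (μ.real Set.univ)) :=
    (ENNReal.tendsto_toReal (measure_ne_top _ _)).comp t1
  have t2' : Filter.Tendsto (fun t => μ.real {x | N x < t}) Filter.atBot (nhds 0) := by
    have := (ENNReal.tendsto_toReal (ENNReal.zero_ne_top)).comp t2
    rw [ENNReal.toReal_zero] at this
    exact this
  obtain ⟨b, hb⟩ := (t1'.eventually (lt_mem_nhds hs2)).exists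
  obtain ⟨a, ha⟩ := (t2'.eventually (gt_mem_nhds hs)).exists
  exact mem_range_of_exists_le_of_exists_ge hc ⟨a, le_of_lt ha⟩ ⟨b, le_of_lt hb⟩

/-- probability integral transform -/
theorem map_eq_of_bounds {α : Type*} [MeasurableSpace α] (μ : Measure α) [IsFiniteMeasure μ] (τ : α → ℝ)
    (hτ : Measurable τ) (h0 : ∀ x, 0 ≤ τ x) (h1 : ∀ x, τ x ≤ μ.real Set.univ)
    (hb : ∀ s, 0 < s → s < μ.real Set.univ → μ.real {x | τ x < s} ≤ s ∧ s ≤ μ.real {x | τ x ≤ s}) :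
    Measure.map τ μ = volume.restrict (Set.Icc 0 (μ.real Set.univ)) := by
  set L := μ.real Set.univ with hL
  have : IsFiniteMeasure (Measure.map τ μ) := inferInstance
  apply Measure.ext_of_Iic
  intro s
  rw [Measure.map_apply hτ measurableSet_Iic, Measure.restrict_apply measurableSet_Iic]
  have L0 : 0 ≤ L := measureReal_nonneg
  have up : ∀ s, 0 ≤ s → s < L → μ.real {x | τ x ≤ s} ≤ s := by
    intro s hs hsL
    apply le_of_forall_gt_imp_ge_of_dense
    intro s' hs'
    by_cases hc : s' < L
    · refine le_trans ?_ (hb s' (lt_of_le_of_lt hs hs') hc).1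
      exact measureReal_mono fun x hx => lt_of_le_of_lt (show τ x ≤ s from hx) hs'
    · exact (measureReal_mono (Set.subset_univ _)).trans (not_lt.1 hc)
  rcases lt_or_ge s 0 with hs | hs
  · have e1 : τ ⁻¹' Set.Iic s = ∅ := by
      ext x; simp only [Set.mem_preimage, Set.mem_Iic, Set.mem_empty_iff_false, iff_false, not_le]
      exact lt_of_lt_of_le hs (h0 x)
    have e2 : Set.Iic s ∩ Set.Icc 0 L = ∅ := by
      ext x; simp only [Set.mem_inter_iff, Set.mem_Iic, Set.mem_Icc, Set.mem_empty_iff_false, iff_false]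
      rintro ⟨a, b, c⟩; linarith
    rw [e1, e2]; simp
  rcases lt_or_ge s L with hsL | hsL
  · have e2 : Set.Iic s ∩ Set.Icc 0 L = Set.Icc 0 s := by
      ext x; simp only [Set.mem_inter_iff, Set.mem_Iic, Set.mem_Icc]
      constructor
      · rintro ⟨a, b, c⟩; exact ⟨b, a⟩
      · rintro ⟨a, b⟩; exact ⟨b, a, by linarith⟩
    rw [e2, Real.volume_Icc, sub_zero, ← ofReal_measureReal (measure_ne_top _ _)]
    congr 1
    apply le_antisymm (up s hs hsL)
    rcases hs.eq_or_lt with h | h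
    · rw [← h]; exact measureReal_nonneg
    · exact (hb s h hsL).2
  · have e1 : τ ⁻¹' Set.Iic s = Set.univ := by
      ext x; simp only [Set.mem_preimage, Set.mem_Iic, Set.mem_univ, iff_true]
      exact (h1 x).trans hsL
    have e2 : Set.Iic s ∩ Set.Icc 0 L = Set.Icc 0 L := by
      ext x; simp only [Set.mem_inter_iff, Set.mem_Iic, Set.mem_Icc]
      constructor
      · rintro ⟨a, b, c⟩; exact ⟨b, c⟩
      · rintro ⟨a, b⟩; exact ⟨by linarith, a, b⟩
    rw [e1, e2, Real.volume_Icc, sub_zero, hL, ofReal_measureReal (measure_ne_top _ _)]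

theorem rank_N {α : Type*} [MeasurableSpace α] (μ : Measure α) [IsFiniteMeasure μ] (N : α → ℝ)
    (hN : Measurable N) (hl : ∀ c, μ {x | N x = c} = 0) :
    Measurable (fun x => μ.real {y | N y < N x}) ∧
    Measure.map (fun x => μ.real {y | N y < N x}) μ = volume.restrict (Set.Icc 0 (μ.real Set.univ)) := by
  have hm : Measurable (fun t => μ.real {y | N y < t}) := by
    have : Monotone (fun t => μ.real {y | N y < t}) := fun a b hab =>
      measureReal_mono fun x hx => lt_of_lt_of_le (show N x < a from hx) hab
    exact this.measurable
  have hτ : Measurable (fun x => μ.real {y | N y < N x}) := hm.comp hN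
  refine ⟨hτ, map_eq_of_bounds μ _ hτ (fun x => measureReal_nonneg)
    (fun x => measureReal_mono (Set.subset_univ _)) ?_⟩
  intro s hs hsL
  obtain ⟨t, ht⟩ := exists_cdf_eq μ N hN hl s hs hsL
  constructor
  · conv_rhs => rw [← ht]
    refine measureReal_mono ?_
    intro x hx
    by_contra hcon
    have hcon' : t ≤ N x := not_lt.1 hcon
    have : μ.real {y | N y < t} ≤ μ.real {y | N y < N x} :=
      measureReal_mono fun y hy => lt_of_lt_of_le (show N y < t from hy) hcon'
    have hx' : μ.real {y | N y < N x} < s := hx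
    linarith
  · conv_lhs => rw [← ht]
    refine measureReal_mono ?_
    intro x hx
    have hx' : N x < t := hx
    show μ.real {y | N y < N x} ≤ s
    rw [← ht]
    exact measureReal_mono fun y hy => lt_trans (show N y < N x from hy) hx'

theorem exists_rank {α : Type*} [MeasurableSpace α] (μ : Measure α) [IsFiniteMeasure μ] (v p : α → ℝ)
    (hv : Measurable v) (hp : Measurable p) (hpl : ∀ c, μ {x | p x = c} = 0) :
    ∃ τ : α → ℝ, Measurable τ ∧ Measure.map τ μ = volume.restrict (Set.Icc 0 (μ.real Set.univ)) ∧
      (∀ x y, τ y < τ x → v x ≤ v y) ∧ (∀ x y, v x < v y → τ y ≤ τ x) ∧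
      (∀ x, τ x ≤ μ.real {y | v x ≤ v y}) ∧ (∀ x, μ.real Set.univ - τ x ≤ μ.real {y | v y ≤ v x}) := by
  set θ : ℝ → ℝ := fun s => 1 / 2 - Real.arctan s / π with hθ
  have θanti : StrictAnti θ := by
    intro a b hab
    have := Real.arctan_strictMono hab
    have h2 : Real.arctan a / π < Real.arctan b / π := div_lt_div_of_pos_right this Real.pi_pos
    simp only [hθ]; linarith
  have θ0 : ∀ s, 0 ≤ θ s := by
    intro s
    have h1 : Real.arctan s / π ≤ 1 / 2 := by
      rw [div_le_iff₀ Real.pi_pos]; linarith [Real.arctan_lt_pi_div_two s]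
    simp only [hθ]; linarith
  have θ1 : ∀ s, θ s ≤ 1 := by
    intro s
    have h1 : -(1 / 2) ≤ Real.arctan s / π := by
      rw [le_div_iff₀ Real.pi_pos]; linarith [Real.neg_pi_div_two_lt_arctan s]
    simp only [hθ]; linarith
  have θm : Measurable θ := by
    have := Real.continuous_arctan.measurable
    simp only [hθ]; fun_prop
  set H : ℝ → ℝ := fun t => μ.real {y | v y < t} with hH
  set K : ℝ → ℝ := fun t => μ.real {y | v y ≤ t} with hK
  have Hm : Measurable H := by
    have : Monotone H := fun a b hab =>
      measureReal_mono fun x hx => lt_of_lt_of_le (show v x < a from hx) hab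
    exact this.measurable
  have Km : Measurable K := by
    have : Monotone K := fun a b hab =>
      measureReal_mono fun x hx => le_trans (show v x ≤ a from hx) hab
    exact this.measurable
  have HK : ∀ t, H t ≤ K t := fun t => measureReal_mono fun x hx => le_of_lt (show v x < t from hx)
  have KH : ∀ s t, s < t → K s ≤ H t := fun s t hst =>
    measureReal_mono fun x hx => lt_of_le_of_lt (show v x ≤ s from hx) hst
  set N : α → ℝ := fun x => - v x - H (v x) - (K (v x) - H (v x)) * θ (p x) with hNd
  have hN : Measurable N := by
    have a1 := Hm.comp hv
    have a2 := Km.comp hv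
    have a3 := θm.comp hp
    exact (hv.neg.sub a1).sub ((a2.sub a1).mul a3)
  have ord : ∀ x y, v x < v y → N y < N x := by
    intro x y hxy
    have h1 := KH _ _ hxy
    have h2 : 0 ≤ (K (v y) - H (v y)) * θ (p y) := mul_nonneg (sub_nonneg.2 (HK _)) (θ0 _)
    have h3 : (K (v x) - H (v x)) * θ (p x) ≤ K (v x) - H (v x) :=
      mul_le_of_le_one_right (sub_nonneg.2 (HK _)) (θ1 _)
    simp only [hNd]; linarith
  have hl : ∀ c, μ {x | N x = c} = 0 := by
    intro c
    by_cases hne : ∃ x0, N x0 = c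
    · obtain ⟨x0, hx0⟩ := hne
      have hsame : ∀ x, N x = c → v x = v x0 := by
        intro x hx
        by_contra hc
        rcases lt_or_gt_of_ne hc with h | h
        · have := ord _ _ h; linarith
        · have := ord _ _ h; linarith
      by_cases hz : K (v x0) - H (v x0) = 0
      · have hz2 : μ {x | v x = v x0} = 0 := by
          have e : {y | v y ≤ v x0} = {y | v y < v x0} ∪ {x | v x = v x0} := by
            ext y; simp only [Set.mem_ofPred_eq, Set.mem_union]; exact le_iff_lt_or_eq
          have d : Disjoint {y | v y < v x0} {x | v x = v x0} := by
            rw [Set.disjoint_left]; intro y h1 h2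
            have h1' : v y < v x0 := h1
            have h2' : v y = v x0 := h2
            linarith
          have := measureReal_union (μ := μ) d (measurableSet_eq_fun hv measurable_const)
          rw [← e] at this
          have h3 : μ.real {x | v x = v x0} = 0 := by
            simp only [hH, hK] at hz; linarith
          exact (measureReal_eq_zero_iff).1 h3
        exact measure_mono_null (fun x hx => hsame x hx) hz2
      · refine measure_mono_null ?_ (hpl (p x0))
        intro x hx
        have h1 := hsame x hx
        have h2 : N x = N x0 := (show N x = c from hx).trans hx0.symm
        simp only [hNd, h1] at h2
        have h3 : (K (v x0) - H (v x0)) * θ (p x) = (K (v x0) - H (v x0)) * θ (p x0) := by linarith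
        exact θanti.injective (mul_left_cancel₀ hz h3)
    · have : {x | N x = c} = ∅ := by
        ext x; simp only [Set.mem_ofPred_eq, Set.mem_empty_iff_false, iff_false]
        exact fun h => hne ⟨x, h⟩
      rw [this]; simp
  obtain ⟨r1, r2⟩ := rank_N μ N hN hl
  refine ⟨_, r1, r2, ?_, ?_, ?_, ?_⟩
  · intro x y h
    by_contra hcon
    have h1 := ord y x (not_le.1 hcon)
    have : μ.real {z | N z < N x} ≤ μ.real {z | N z < N y} :=
      measureReal_mono fun z hz => lt_trans (show N z < N x from hz) h1
    have h' : μ.real {z | N z < N y} < μ.real {z | N z < N x} := h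
    linarith
  · intro x y h
    exact measureReal_mono fun z hz => lt_trans (show N z < N y from hz) (ord x y h)
  · intro x
    refine measureReal_mono ?_
    intro y hy
    by_contra hcon
    have := ord y x (not_le.1 hcon)
    have hy' : N y < N x := hy
    linarith
  · intro x
    have hms : MeasurableSet {y | N y < N x} := measurableSet_lt hN measurable_const
    have : μ.real Set.univ - μ.real {y | N y < N x} = μ.real {y | N y < N x}ᶜ := by
      rw [measureReal_compl hms]
    show μ.real Set.univ - μ.real {y | N y < N x} ≤ _
    rw [this]
    refine measureReal_mono ?_
    intro y hy
    by_contra hcon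
    exact hy (ord x y (not_le.1 hcon))

end PartC

section PartE

variable {α : Type*} [MeasurableSpace α] {μ : Measure α} [IsFiniteMeasure μ]

theorem cs_set (ψ : α → ℝ) (h1 : Integrable ψ μ) (h2 : Integrable (fun x => ψ x ^ 2) μ) (S : Set α) :
    (∫ x in S, ψ x ∂μ) ^ 2 ≤ μ.real S * ∫ x, ψ x ^ 2 ∂μ := by
  have := cs_int (μ := μ.restrict S) (fun _ => 1) ψ (fun x => ψ x ^ 2) (integrable_const _) h1.integrableOn
    h2.integrableOn (fun _ => zero_le_one) (fun _ => sq_nonneg _) (fun x => by rw [one_mul])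
  refine this.trans ?_
  rw [setIntegral_const, smul_eq_mul, mul_one]
  exact mul_le_mul_of_nonneg_left
    (setIntegral_le_integral h2 (Filter.Eventually.of_forall fun x => sq_nonneg _)) measureReal_nonneg

theorem ae_range (τ : α → ℝ) (hτ : Measurable τ) (hmap : Measure.map τ μ = volume.restrict (Set.Icc 0 π)) :
    ∀ᵐ x ∂μ, 0 < τ x ∧ τ x < π := by
  have h : ∀ᵐ s ∂(Measure.map τ μ), 0 < s ∧ s < π := by
    rw [hmap, ae_restrict_iff' measurableSet_Icc]
    have h0 : ∀ᵐ s : ℝ, s ≠ 0 := by simp [ae_iff]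
    have h1 : ∀ᵐ s : ℝ, s ≠ π := by simp [ae_iff]
    filter_upwards [h0, h1] with s a b hs
    exact ⟨lt_of_le_of_ne hs.1 a.symm, lt_of_le_of_ne hs.2 b⟩
  exact ae_of_ae_map hτ.aemeasurable h

theorem level_null (τ : α → ℝ) (hτ : Measurable τ) (hmap : Measure.map τ μ = volume.restrict (Set.Icc 0 π))
    (c : ℝ) : μ {x | τ x = c} = 0 := by
  have : Measure.map τ μ {c} = 0 := by
    rw [hmap]
    exact le_antisymm ((Measure.restrict_apply_le _ _).trans (by simp)) (zero_le)
  rw [Measure.map_apply hτ (measurableSet_singleton c)] at this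
  exact this

theorem push_int (τ : α → ℝ) (hτ : Measurable τ) (hmap : Measure.map τ μ = volume.restrict (Set.Icc 0 π))
    (H : ℝ → ℝ) (hH : Measurable H) : ∫ x, H (τ x) ∂μ = ∫ s in Set.Icc 0 π, H s := by
  rw [← hmap, integral_map hτ.aemeasurable hH.aestronglyMeasurable]

theorem push_integrable (τ : α → ℝ) (hτ : Measurable τ) (hmap : Measure.map τ μ = volume.restrict (Set.Icc 0 π))
    (H : ℝ → ℝ) (hH : Continuous H) : Integrable (fun x => H (τ x)) μ := by
  have : Integrable H (Measure.map τ μ) := by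
    rw [hmap]; exact hH.integrableOn_Icc
  exact this.comp_measurable hτ

theorem push_sub (τ : α → ℝ) (hτ : Measurable τ) (hmap : Measure.map τ μ = volume.restrict (Set.Icc 0 π))
    (H : ℝ → ℝ) (hH : Measurable H) (t : ℝ) (ht : 0 ≤ t) (ht2 : t ≤ π) :
    ∫ x in {x | τ x < t}, H (τ x) ∂μ = ∫ s in (0:ℝ)..t, H s := by
  have e : ∫ x in {x | τ x < t}, H (τ x) ∂μ = ∫ s in Set.Iio t, H s ∂(Measure.map τ μ) := by
    rw [setIntegral_map measurableSet_Iio hH.aestronglyMeasurable hτ.aemeasurable]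
    rfl
  rw [e, hmap, Measure.restrict_restrict measurableSet_Iio, intervalIntegral.integral_of_le ht,
    ← integral_Icc_eq_integral_Ioc, integral_Icc_eq_integral_Ico]
  congr 2
  ext s
  simp only [Set.mem_inter_iff, Set.mem_Iio, Set.mem_Icc, Set.mem_Ico]
  constructor
  · rintro ⟨a, b, c⟩; exact ⟨b, a⟩
  · rintro ⟨a, b⟩; exact ⟨b, a, by linarith⟩

theorem parts_rank (τ : α → ℝ) (hτ : Measurable τ) (hmap : Measure.map τ μ = volume.restrict (Set.Icc 0 π))
    (f : α → ℝ) (hf : Integrable f μ) (f0 : ∫ x, f x ∂μ = 0) (g g' : ℝ → ℝ)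
    (hg : ∀ s, HasDerivAt g (g' s) s) (hg' : Continuous g') :
    ∫ x, g (τ x) * f x ∂μ = - ∫ x, g' (τ x) * (∫ y in {y | τ y < τ x}, f y ∂μ) ∂μ := by
  have hE : Continuous (fun t => ∫ y in {y | τ y < t}, f y ∂μ) := by
    apply cont_sublevel τ hτ f hf
    intro c
    filter_upwards [measure_eq_zero_iff_ae_notMem.1 (level_null τ hτ hmap c)] with x hx h2
    exact absurd h2 hx
  rw [push_int τ hτ hmap (fun s => g' s * (∫ y in {y | τ y < s}, f y ∂μ)) (hg'.mul hE).measurable]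
  set S : Set (α × ℝ) := {p | τ p.1 < p.2} with hS
  have hSm : MeasurableSet S := measurableSet_lt (hτ.comp measurable_fst) measurable_snd
  have hIntg : Integrable (fun p : α × ℝ => S.indicator (fun p => f p.1 * g' p.2) p)
      (μ.prod (volume.restrict (Set.Icc 0 π))) := by
    apply Integrable.indicator _ hSm
    exact Integrable.mul_prod (f := f) (g := g') hf hg'.integrableOn_Icc
  have sw := integral_integral_swap (f := fun x t => S.indicator (fun p => f p.1 * g' p.2) (x, t)) hIntg
  have l1 : ∀ᵐ x ∂μ, ∫ t in Set.Icc 0 π, S.indicator (fun p => f p.1 * g' p.2) (x, t)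
      = g π * f x - g (τ x) * f x := by
    filter_upwards [ae_range τ hτ hmap] with x hx
    have e1 : ∫ t in Set.Icc 0 π, S.indicator (fun p => f p.1 * g' p.2) (x, t)
        = ∫ t in Set.Ioc (τ x) π, f x * g' t := by
      rw [← integral_indicator measurableSet_Icc, ← integral_indicator measurableSet_Ioc]
      congr 1; ext t
      simp only [Set.indicator_apply, hS, Set.mem_ofPred_eq, Set.mem_Icc, Set.mem_Ioc]
      by_cases h1 : τ x < t
      · by_cases h2 : t ≤ π
        · have : 0 ≤ t := by linarith [hx.1]
          simp [h1, h2, this]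
        · simp [h2]
      · simp [h1]
    rw [e1, integral_const_mul, ← intervalIntegral.integral_of_le hx.2.le,
      intervalIntegral.integral_eq_sub_of_hasDerivAt (fun s _ => hg s) (hg'.intervalIntegrable _ _)]
    ring
  have l2 : ∀ t, ∫ x, S.indicator (fun p => f p.1 * g' p.2) (x, t) ∂μ
      = g' t * ∫ y in {y | τ y < t}, f y ∂μ := by
    intro t
    rw [← integral_const_mul, ← integral_indicator (measurableSet_lt hτ measurable_const)]
    congr 1; ext x
    simp only [Set.indicator_apply, hS, Set.mem_ofPred_eq]
    split_ifs
    · ring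
    · rfl
  rw [integral_congr_ae l1] at sw
  simp only [l2] at sw
  have hgc : Continuous g := continuous_iff_continuousAt.2 fun s => (hg s).continuousAt
  have hgf : Integrable (fun x => g (τ x) * f x) μ := by
    obtain ⟨C, hC⟩ := isCompact_Icc.exists_bound_of_continuousOn (hgc.continuousOn (s := Set.Icc 0 π))
    apply hf.bdd_mul (c := C) (hgc.measurable.comp hτ).aestronglyMeasurable
    filter_upwards [ae_range τ hτ hmap] with x hx
    exact hC _ ⟨hx.1.le, hx.2.le⟩
  rw [integral_sub (hf.const_mul _) hgf, integral_const_mul, f0, mul_zero, zero_sub] at sw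
  rw [← sw, neg_neg]

end PartE

section PartE2

variable {α : Type*} [MeasurableSpace α] {μ : Measure α} [IsFiniteMeasure μ]

theorem rank_measure (τ : α → ℝ) (hτ : Measurable τ) (hmap : Measure.map τ μ = volume.restrict (Set.Icc 0 π))
    (t : ℝ) (ht : 0 ≤ t) (ht2 : t ≤ π) : μ.real {x | τ x < t} = t := by
  have := push_sub τ hτ hmap (fun _ => 1) measurable_const t ht ht2
  simpa using this

theorem rank_univ (τ : α → ℝ) (hτ : Measurable τ) (hmap : Measure.map τ μ = volume.restrict (Set.Icc 0 π)) :
    μ.real Set.univ = π := by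
  have := push_int τ hτ hmap (fun _ => 1) measurable_const
  simpa [Real.pi_pos.le] using this

theorem cs_rank (τ : α → ℝ) (hτ : Measurable τ) (hmap : Measure.map τ μ = volume.restrict (Set.Icc 0 π))
    (ψ : α → ℝ) (h1 : Integrable ψ μ) (h2 : Integrable (fun x => ψ x ^ 2) μ) (h0 : ∫ x, ψ x ∂μ = 0)
    (t : ℝ) (ht : 0 ≤ t) (ht2 : t ≤ π) :
    (∫ x in {x | τ x < t}, ψ x ∂μ) ^ 2 ≤ t * ∫ x, ψ x ^ 2 ∂μ ∧
    (∫ x in {x | τ x < t}, ψ x ∂μ) ^ 2 ≤ (π - t) * ∫ x, ψ x ^ 2 ∂μ := by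
  have hms : MeasurableSet {x | τ x < t} := measurableSet_lt hτ measurable_const
  have m1 := rank_measure τ hτ hmap t ht ht2
  constructor
  · have := cs_set ψ h1 h2 {x | τ x < t}
    rwa [m1] at this
  · have := cs_set ψ h1 h2 {x | τ x < t}ᶜ
    rw [measureReal_compl hms, m1, rank_univ τ hτ hmap] at this
    rw [← integral_add_compl hms h1] at h0
    have e : ∫ x in {x | τ x < t}, ψ x ∂μ = - ∫ x in {x | τ x < t}ᶜ, ψ x ∂μ := by linarith
    rw [e, neg_sq]
    exact this

theorem pointwise_P (κ S τ e q : ℝ) (κ0 : 0 ≤ κ) (τ0 : 0 < τ) (S0 : 0 ≤ S)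
    (h1 : (e - τ * q) ^ 2 ≤ τ * S) :
    -(κ * S) ≤ (1 / (4 * π) + κ * q) * e - κ / 2 * (τ * q * q) - ((1 / (4 * π)) * e + κ / 2 * (e ^ 2 / τ)) := by
  have e1 : (1 / (4 * π) + κ * q) * e - κ / 2 * (τ * q * q) - ((1 / (4 * π)) * e + κ / 2 * (e ^ 2 / τ))
      = - (κ / 2 * ((e - τ * q) ^ 2 / τ)) := by
    field_simp; ring
  rw [e1]
  have : (e - τ * q) ^ 2 / τ ≤ S := by rw [div_le_iff₀ τ0]; linarith
  have := mul_le_mul_of_nonneg_left this κ0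
  nlinarith [mul_nonneg κ0 S0]

theorem pointwise_N (κ S τ e q M0 : ℝ) (κ0 : 0 ≤ κ) (τ0 : 0 < τ) (τ1 : τ < π) (e0 : 0 ≤ e)
    (h1 : (e - τ * q) ^ 2 ≤ τ * S) (h2 : (e - τ * q) ^ 2 ≤ (π - τ) * S) (hM : τ * q ≤ M0 * (π - τ))
    (hκ : κ * M0 ≤ 1 / (4 * π)) :
    -(κ * S) ≤ (1 / (4 * π) + κ * q) * e - κ / 2 * (τ * q * q) - κ / 2 * (e ^ 2 / (π - τ)) := by
  have hp : 0 < π - τ := by linarith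
  have a1 : q * e - τ * q * q / 2 ≥ - (S / 2) := by
    have : (e - τ * q) ^ 2 / τ ≤ S := by rw [div_le_iff₀ τ0]; linarith
    have e1 : q * e - τ * q * q / 2 = - ((e - τ * q) ^ 2 / τ) / 2 + e ^ 2 / (2 * τ) := by
      field_simp; ring
    have : 0 ≤ e ^ 2 / (2 * τ) := by positivity
    rw [e1]; linarith
  have a2 : e ^ 2 / (π - τ) ≤ 2 * e * M0 + S := by
    rw [div_le_iff₀ hp]
    have : e * (τ * q) ≤ e * (M0 * (π - τ)) := mul_le_mul_of_nonneg_left hM e0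
    nlinarith [sq_nonneg (τ * q)]
  have a3 := mul_le_mul_of_nonneg_left a1 κ0
  have a4 := mul_le_mul_of_nonneg_left a2 κ0
  have a5 := mul_le_mul_of_nonneg_right hκ e0
  nlinarith

theorem core_ineq (τ : α → ℝ) (hτ : Measurable τ)
    (hmap : Measure.map τ μ = volume.restrict (Set.Icc 0 π))
    (f : α → ℝ) (hf : Integrable f μ) (hf2 : Integrable (fun x => f x ^ 2) μ) (f0 : ∫ x, f x ∂μ = 0)
    (e : α → ℝ) (he : ∀ x, e x = ∫ y in {y | τ y < τ x}, f y ∂μ) (e0 : ∀ x, 0 ≤ e x)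
    (P : Set α) (hP : MeasurableSet P)
    (F g q : ℝ → ℝ) (κ M0 : ℝ) (hF : ∀ s, HasDerivAt F (g s) s)
    (hg : ∀ s, HasDerivAt g (-(1 / (4 * π)) - κ * q s) s) (hq : Continuous q)
    (hFq : ∀ s, F s = s * q s) (Fpi : F π = 0)
    (hM0 : ∀ s ∈ Set.Icc 0 π, F s ≤ M0 * (π - s)) (κ0 : 0 ≤ κ) (hκ : κ * π ≤ 1 / 2)
    (hκM : κ * M0 ≤ 1 / (4 * π)) :
    IntegrableOn (fun x => e x ^ 2 / τ x) P μ ∧ IntegrableOn (fun x => e x ^ 2 / (π - τ x)) Pᶜ μ ∧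
    -(1 / (8 * π)) * (∫ s in (0:ℝ)..π, F s) ≤ 1 / 2 * (∫ x, f x ^ 2 ∂μ) - 1 / (4 * π) * (∫ x in P, e x ∂μ)
      - κ / 2 * ((∫ x in P, e x ^ 2 / τ x ∂μ) + ∫ x in Pᶜ, e x ^ 2 / (π - τ x) ∂μ) := by
  have hpi := Real.pi_pos
  have hgc : Continuous g := continuous_iff_continuousAt.2 fun s => (hg s).continuousAt
  have hFc : Continuous F := continuous_iff_continuousAt.2 fun s => (hF s).continuousAt
  have hE : Continuous (fun t => ∫ y in {y | τ y < t}, f y ∂μ) := by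
    apply cont_sublevel τ hτ f hf
    intro c
    filter_upwards [measure_eq_zero_iff_ae_notMem.1 (level_null τ hτ hmap c)] with x hx h2
    exact absurd h2 hx
  set E : ℝ → ℝ := fun t => ∫ y in {y | τ y < t}, f y ∂μ with hEd
  have heE : ∀ x, e x = E (τ x) := he
  have hem : Measurable e := by
    have : e = fun x => E (τ x) := funext heE
    rw [this]; exact hE.measurable.comp hτ
  have F0 : F 0 = 0 := by rw [hFq]; ring
  set A := ∫ x, f x ^ 2 ∂μ with hA
  -- the function ψ
  have hgi : Integrable (fun x => g (τ x)) μ := push_integrable τ hτ hmap g hgc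
  have hg2i : Integrable (fun x => g (τ x) ^ 2) μ := push_integrable τ hτ hmap (fun s => g s ^ 2) (hgc.pow 2)
  have hgf : Integrable (fun x => g (τ x) * f x) μ := by
    obtain ⟨C, hC⟩ := isCompact_Icc.exists_bound_of_continuousOn (hgc.continuousOn (s := Set.Icc 0 π))
    apply hf.bdd_mul (c := C) (hgc.measurable.comp hτ).aestronglyMeasurable
    filter_upwards [ae_range τ hτ hmap] with x hx
    exact hC _ ⟨hx.1.le, hx.2.le⟩
  set ψ : α → ℝ := fun x => f x - g (τ x) with hψ
  have hψi : Integrable ψ μ := hf.sub hgi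
  have hψe : (fun x => ψ x ^ 2) = fun x => f x ^ 2 - 2 * (g (τ x) * f x) + g (τ x) ^ 2 := by
    ext x; simp only [hψ]; ring
  have hi3 : Integrable (fun x => f x ^ 2 - 2 * (g (τ x) * f x)) μ := hf2.sub (hgf.const_mul 2)
  have hψ2 : Integrable (fun x => ψ x ^ 2) μ := by
    rw [hψe]; exact hi3.add hg2i
  set S := ∫ x, ψ x ^ 2 ∂μ with hS
  have S0 : 0 ≤ S := integral_nonneg fun x => sq_nonneg _
  have hSe : S = A - 2 * (∫ x, g (τ x) * f x ∂μ) + ∫ x, g (τ x) ^ 2 ∂μ := by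
    rw [hS, hψe, integral_add hi3 hg2i, integral_sub hf2 (hgf.const_mul 2), integral_const_mul]
  have hIntg_g : ∀ t, ∫ s in (0:ℝ)..t, g s = F t := by
    intro t
    rw [intervalIntegral.integral_eq_sub_of_hasDerivAt (fun s _ => hF s) (hgc.intervalIntegrable _ _), F0, sub_zero]
  have hψ0 : ∫ x, ψ x ∂μ = 0 := by
    have : ∫ x, g (τ x) ∂μ = 0 := by
      rw [push_int τ hτ hmap g hgc.measurable, integral_Icc_eq_integral_Ioc,
        ← intervalIntegral.integral_of_le hpi.le, hIntg_g, Fpi]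
    rw [hψ, integral_sub hf hgi, f0, this, sub_zero]
  have hφ : ∀ x, 0 < τ x → τ x < π → (e x - τ x * q (τ x)) ^ 2 ≤ τ x * S ∧
      (e x - τ x * q (τ x)) ^ 2 ≤ (π - τ x) * S := by
    intro x h1 h2
    have h3 := cs_rank τ hτ hmap ψ hψi hψ2 hψ0 (τ x) h1.le h2.le
    have h4 : ∫ y in {y | τ y < τ x}, ψ y ∂μ = e x - τ x * q (τ x) := by
      rw [hψ, integral_sub hf.integrableOn hgi.integrableOn,
        push_sub τ hτ hmap g hgc.measurable _ h1.le h2.le, hIntg_g, he, hFq]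
    rwa [h4] at h3
  have heA : ∀ x, 0 < τ x → τ x < π → e x ^ 2 ≤ τ x * A ∧ e x ^ 2 ≤ (π - τ x) * A := by
    intro x h1 h2
    have h3 := cs_rank τ hτ hmap f hf hf2 f0 (τ x) h1.le h2.le
    rwa [← he] at h3
  have A0 : 0 ≤ A := integral_nonneg fun x => sq_nonneg _
  -- integrability
  have j1 : Integrable (fun x => e x ^ 2 / τ x) μ := by
    refine Integrable.of_bound ((hem.pow_const 2).div hτ).aestronglyMeasurable A ?_
    filter_upwards [ae_range τ hτ hmap] with x hx
    rw [Real.norm_of_nonneg (div_nonneg (sq_nonneg _) hx.1.le), div_le_iff₀ hx.1, mul_comm]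
    exact (heA x hx.1 hx.2).1
  have j2 : Integrable (fun x => e x ^ 2 / (π - τ x)) μ := by
    refine Integrable.of_bound ((hem.pow_const 2).div (measurable_const.sub hτ)).aestronglyMeasurable A ?_
    filter_upwards [ae_range τ hτ hmap] with x hx
    rw [Real.norm_of_nonneg (div_nonneg (sq_nonneg _) (by linarith [hx.2])), div_le_iff₀ (by linarith [hx.2]), mul_comm]
    exact (heA x hx.1 hx.2).2
  have j3 : Integrable e μ := by
    have : e = fun x => E (τ x) := funext heE
    rw [this]; exact push_integrable τ hτ hmap E hE
  have j4 : Integrable (fun x => (1 / (4 * π) + κ * q (τ x)) * e x) μ := by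
    simp only [heE]
    exact push_integrable τ hτ hmap (fun s => (1 / (4 * π) + κ * q s) * E s) (by fun_prop)
  have j5 : Integrable (fun x => τ x * q (τ x) * q (τ x)) μ :=
    push_integrable τ hτ hmap (fun s => s * q s * q s) (by fun_prop)
  have j6 : Integrable (fun x => F (τ x)) μ := push_integrable τ hτ hmap F hFc
  refine ⟨j1.integrableOn, j2.integrableOn, ?_⟩
  -- identities
  have id1 : ∫ x, g (τ x) * f x ∂μ = ∫ x, (1 / (4 * π) + κ * q (τ x)) * e x ∂μ := by
    rw [parts_rank τ hτ hmap f hf f0 g _ hg (by fun_prop), ← integral_neg]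
    congr 1; ext x
    rw [he]; ring
  have id2 : ∫ x, g (τ x) ^ 2 ∂μ = 1 / (4 * π) * (∫ x, F (τ x) ∂μ) + κ * ∫ x, τ x * q (τ x) * q (τ x) ∂μ := by
    have h1 : ∫ x, (g (τ x) * g (τ x) + F (τ x) * (-(1 / (4 * π)) - κ * q (τ x))) ∂μ = 0 := by
      rw [push_int τ hτ hmap (fun s => g s * g s + F s * (-(1 / (4 * π)) - κ * q s))
        (Continuous.measurable (by fun_prop)), integral_Icc_eq_integral_Ioc,
        ← intervalIntegral.integral_of_le hpi.le,
        intervalIntegral.integral_eq_sub_of_hasDerivAt (f := fun s => F s * g s)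
          (fun s _ => (hF s).mul (hg s)) (Continuous.intervalIntegrable (by fun_prop) _ _), F0, Fpi]
      ring
    have h2 : (fun x => g (τ x) * g (τ x) + F (τ x) * (-(1 / (4 * π)) - κ * q (τ x)))
        = fun x => g (τ x) ^ 2 - (1 / (4 * π) * F (τ x) + κ * (τ x * q (τ x) * q (τ x))) := by
      ext x; rw [hFq]; ring
    have i1 : Integrable (fun x => 1 / (4 * π) * F (τ x) + κ * (τ x * q (τ x) * q (τ x))) μ :=
      (j6.const_mul _).add (j5.const_mul _)
    rw [h2, integral_sub hg2i i1, integral_add (j6.const_mul _) (j5.const_mul _), integral_const_mul,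
      integral_const_mul] at h1
    linarith
  have id3 : ∫ x, F (τ x) ∂μ = ∫ s in (0:ℝ)..π, F s := by
    rw [push_int τ hτ hmap F hFc.measurable, integral_Icc_eq_integral_Ioc,
      ← intervalIntegral.integral_of_le hpi.le]
  -- pointwise
  set R : α → ℝ := fun x => (1 / (4 * π) + κ * q (τ x)) * e x - κ / 2 * (τ x * q (τ x) * q (τ x))
    - P.indicator (fun x => 1 / (4 * π) * e x + κ / 2 * (e x ^ 2 / τ x)) x
    - Pᶜ.indicator (fun x => κ / 2 * (e x ^ 2 / (π - τ x))) x with hR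
  have k1 : Integrable (fun x => 1 / (4 * π) * e x + κ / 2 * (e x ^ 2 / τ x)) μ :=
    (j3.const_mul _).add (j1.const_mul _)
  have k2 : Integrable (fun x => κ / 2 * (e x ^ 2 / (π - τ x))) μ := j2.const_mul _
  have k3 : Integrable (fun x => (1 / (4 * π) + κ * q (τ x)) * e x - κ / 2 * (τ x * q (τ x) * q (τ x))) μ :=
    j4.sub (j5.const_mul _)
  have k4 : Integrable (fun x => (1 / (4 * π) + κ * q (τ x)) * e x - κ / 2 * (τ x * q (τ x) * q (τ x))
    - P.indicator (fun x => 1 / (4 * π) * e x + κ / 2 * (e x ^ 2 / τ x)) x) μ := k3.sub (k1.indicator hP)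
  have k5 : Integrable R μ := k4.sub (k2.indicator hP.compl)
  have hRi : ∫ x, R x ∂μ = (∫ x, (1 / (4 * π) + κ * q (τ x)) * e x ∂μ)
      - κ / 2 * (∫ x, τ x * q (τ x) * q (τ x) ∂μ)
      - (1 / (4 * π) * (∫ x in P, e x ∂μ) + κ / 2 * ∫ x in P, e x ^ 2 / τ x ∂μ)
      - κ / 2 * ∫ x in Pᶜ, e x ^ 2 / (π - τ x) ∂μ := by
    rw [hR, integral_sub k4 (k2.indicator hP.compl), integral_sub k3 (k1.indicator hP),
      integral_sub j4 (j5.const_mul _), integral_const_mul, integral_indicator hP,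
      integral_indicator hP.compl, integral_const_mul,
      integral_add (j3.integrableOn.const_mul _) (j1.integrableOn.const_mul _), integral_const_mul,
      integral_const_mul]
  have hRb : ∫ x, -(κ * S) ∂μ ≤ ∫ x, R x ∂μ := by
    apply integral_mono_ae (integrable_const _) k5
    filter_upwards [ae_range τ hτ hmap] with x hx
    have h1 := hφ x hx.1 hx.2
    by_cases hxP : x ∈ P
    · have hxc : x ∉ Pᶜ := fun h => h hxP
      simp only [hR, Set.indicator_of_mem hxP, Set.indicator_of_notMem hxc, sub_zero]
      exact pointwise_P κ S (τ x) (e x) (q (τ x)) κ0 hx.1 S0 h1.1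
    · have hxc : x ∈ Pᶜ := hxP
      simp only [hR, Set.indicator_of_mem hxc, Set.indicator_of_notMem hxP, sub_zero]
      refine pointwise_N κ S (τ x) (e x) (q (τ x)) M0 κ0 hx.1 hx.2 (e0 x) h1.1 h1.2 ?_ hκM
      rw [← hFq]; exact hM0 _ ⟨hx.1.le, hx.2.le⟩
  rw [integral_const, rank_univ τ hτ hmap, smul_eq_mul, hRi] at hRb
  rw [id1, id2, id3] at hSe
  have hfin : κ * π * S ≤ 1 / 2 * S := mul_le_mul_of_nonneg_right hκ S0
  have h8 : 1 / (8 * π) = 1 / 2 * (1 / (4 * π)) := by field_simp; norm_num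
  rw [h8]
  nlinarith

end PartE2

section PartE3
local notation "E2" => EuclideanSpace ℝ (Fin 2)

theorem coord_null (c : ℝ) : volume {x : E2 | x 0 = c} = 0 := by
  have hu : ContDiff ℝ 1 (fun x : E2 => (EuclideanSpace.proj (0 : Fin 2) : E2 →L[ℝ] ℝ) x) :=
    (EuclideanSpace.proj (0 : Fin 2) : E2 →L[ℝ] ℝ).contDiff
  have h := level_fderiv_null _ hu c (EuclideanSpace.single 0 1)
  rw [ae_iff] at h
  refine measure_mono_null ?_ h
  intro x hx
  simp only [Set.mem_ofPred_eq, Classical.not_imp]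
  refine ⟨hx, ?_⟩
  rw [ContinuousLinearMap.fderiv]
  simp

theorem norm_gradient_eq (v : E2 → ℝ) (x : E2) : ‖gradient v x‖ = ‖fderiv ℝ v x‖ := by
  simp [gradient]

theorem lower_bound (Ω : Set E2) (hΩ : IsOpen Ω) (hvol : volume Ω = ENNReal.ofReal π)
    (v : E2 → ℝ) (hv : ContDiff ℝ 2 v) (hc : HasCompactSupport v) (hsub : tsupport v ⊆ Ω)
    (F g q : ℝ → ℝ) (σ κ M0 : ℝ) (hσ : σ ^ 2 = 4 * π * κ) (hF : ∀ s, HasDerivAt F (g s) s)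
    (hg : ∀ s, HasDerivAt g (-(1 / (4 * π)) - κ * q s) s) (hq : Continuous q)
    (hFq : ∀ s, F s = s * q s) (Fpi : F π = 0)
    (hM0 : ∀ s ∈ Set.Icc 0 π, F s ≤ M0 * (π - s)) (κ0 : 0 ≤ κ) (hκ : κ * π ≤ 1 / 2)
    (hκM : κ * M0 ≤ 1 / (4 * π)) :
    -(1 / (8 * π)) * (∫ s in (0:ℝ)..π, F s) ≤
      (1/2) * (∫ x, (laplacian v x)^2) - (σ^2/2) * (∫ x, ‖gradient v x‖^2) - ∫ x, v x := by
  have hpi := Real.pi_pos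
  have hcv := hv.continuous
  set μ : Measure E2 := volume.restrict Ω with hμ
  have : IsFiniteMeasure μ := ⟨by rw [hμ, Measure.restrict_apply_univ, hvol]; exact ENNReal.ofReal_lt_top⟩
  have huniv : μ.real Set.univ = π := by
    rw [measureReal_def, hμ, Measure.restrict_apply_univ, hvol, ENNReal.toReal_ofReal hpi.le]
  have hac : ∀ s : Set E2, volume s = 0 → μ s = 0 := fun s hs =>
    le_antisymm ((Measure.restrict_apply_le _ _).trans hs.le) (zero_le)
  obtain ⟨τ, hτ, hmap, o1, o2, o3, o4⟩ := exists_rank μ v (fun x => x 0) hcv.measurable (by fun_prop)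
    (fun c => hac _ (coord_null c))
  rw [huniv] at hmap o4
  have hout : ∀ x, x ∉ Ω → v x = 0 := fun x hx => image_eq_zero_of_notMem_tsupport fun h => hx (hsub h)
  have hlout : ∀ x, x ∉ Ω → laplacian v x = 0 := by
    intro x hx
    have h1 : x ∉ tsupport v := fun h => hx (hsub h)
    unfold laplacian
    apply Finset.sum_eq_zero
    intro i _
    have h2 : x ∉ tsupport (fun y => fderiv ℝ v y (EuclideanSpace.single i 1)) :=
      fun h => h1 (tsupport_fderiv_apply_subset ℝ _ h)
    have h3 : x ∉ tsupport (fun y => fderiv ℝ (fun y => fderiv ℝ v y (EuclideanSpace.single i 1)) y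
        (EuclideanSpace.single i 1)) :=
      fun h => h2 (tsupport_fderiv_apply_subset ℝ _ h)
    exact image_eq_zero_of_notMem_tsupport (f := fun y => fderiv ℝ (fun y => fderiv ℝ v y
        (EuclideanSpace.single i 1)) y (EuclideanSpace.single i 1)) h3
  have hli := laplacian_integrable v hv hc
  have hl2 := laplacian_sq_integrable v hv hc
  have f0 : ∫ x, - laplacian v x ∂μ = 0 := by
    rw [← integral_laplacian v hv hc, hμ]
    apply setIntegral_eq_integral_of_forall_compl_eq_zero
    intro x hx; rw [hlout x hx, neg_zero]
  have hA : ∫ x, (- laplacian v x) ^ 2 ∂μ = ∫ x, laplacian v x ^ 2 := by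
    simp only [neg_sq]
    apply setIntegral_eq_integral_of_forall_compl_eq_zero
    intro x hx; rw [hlout x hx]; ring
  have he : ∀ x, fluxD v (v x) = ∫ y in {y | τ y < τ x}, - laplacian v y ∂μ := by
    intro x
    have h1 : fluxD v (v x) = ∫ y in {y | v x < v y}, - laplacian v y ∂μ := by
      unfold fluxD
      rw [← integral_indicator (meas_lt v hv _), ← integral_indicator (meas_lt v hv _), hμ]
      symm
      apply setIntegral_eq_integral_of_forall_compl_eq_zero
      intro y hy
      simp [Set.indicator_apply, hlout y hy]
    have hms : MeasurableSet {y | τ y < τ x} := measurableSet_lt hτ measurable_const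
    rw [h1, ← integral_indicator (meas_lt v hv _), ← integral_indicator hms]
    apply integral_congr_ae
    have n1 : ∀ᵐ y ∂μ, v y = v x → laplacian v y = 0 := ae_restrict_of_ae (laplacian_level v hv (v x))
    have n2 : ∀ᵐ y ∂μ, ¬ τ y = τ x := measure_eq_zero_iff_ae_notMem.1 (level_null τ hτ hmap (τ x))
    filter_upwards [n1, n2] with y h3 h4
    simp only [Set.indicator_apply, Set.mem_ofPred_eq]
    rcases lt_trichotomy (v y) (v x) with h | h | h
    · have a1 : ¬ v x < v y := not_lt.2 h.le
      have a2 : ¬ τ y < τ x := fun h' => absurd (o1 x y h') (not_le.2 h)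
      simp [a1, a2]
    · simp [h3 h]
    · have a2 : τ y < τ x := lt_of_le_of_ne (o2 x y h) h4
      simp [h, a2]
  have hP : MeasurableSet {x | 0 < v x} := meas_lt v hv 0
  obtain ⟨i1, i2, core⟩ := core_ineq τ hτ hmap (fun x => - laplacian v x) hli.neg.integrableOn
    (by simp only [neg_sq]; exact hl2.integrableOn) f0 (fun x => fluxD v (v x)) he
    (fun x => fluxD_nonneg v hv hc _) {x | 0 < v x} hP F g q κ M0 hF hg hq hFq Fpi hM0 κ0 hκ hκM
  simp only [hA] at core
  have hPr : μ.restrict {x | 0 < v x} = volume.restrict {x | 0 < v x} := by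
    rw [hμ, Measure.restrict_restrict hP]
    congr 1; ext x
    simp only [Set.mem_inter_iff, Set.mem_ofPred_eq, and_iff_left_iff_imp]
    intro h; by_contra hx; rw [hout x hx] at h; exact lt_irrefl _ h
  have hNm : MeasurableSet {x | v x < 0} := (isOpen_lt hcv continuous_const).measurableSet
  have hNr : μ.restrict {x | v x < 0} = volume.restrict {x | v x < 0} := by
    rw [hμ, Measure.restrict_restrict hNm]
    congr 1; ext x
    simp only [Set.mem_inter_iff, Set.mem_ofPred_eq, and_iff_left_iff_imp]
    intro h; by_contra hx; rw [hout x hx] at h; exact lt_irrefl _ h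
  have hrange := ae_range τ hτ hmap
  have b1 : ∫ x in {x | 0 < v x}, fluxD v (v x) ^ 2 / volume.real {y | v x ≤ v y}
      ≤ ∫ x in {x | 0 < v x}, fluxD v (v x) ^ 2 / τ x ∂μ := by
    rw [← hPr]
    apply integral_mono_ae _ i1
    · refine (ae_restrict_iff' hP).2 ?_
      filter_upwards [hrange] with x hx hx0
      apply div_le_div_of_nonneg_left (sq_nonneg _) hx.1
      refine (o3 x).trans ?_
      have hfin : volume {y | v x ≤ v y} ≠ ⊤ := (vol_fin v hc (v x) hx0 _ fun y hy => hy).ne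
      exact ENNReal.toReal_mono hfin (Measure.restrict_apply_le _ _)
    · rw [hPr]; exact ratio_integrableOn v hv hc
  have b2 : ∫ x in {x | v x < 0}, fluxD v (v x) ^ 2 / volume.real {y | v y ≤ v x}
      ≤ ∫ x in {x | 0 < v x}ᶜ, fluxD v (v x) ^ 2 / (π - τ x) ∂μ := by
    have hss : {x | v x < 0} ⊆ {x | 0 < v x}ᶜ := fun x hx hx2 => by
      have a1 : v x < 0 := hx
      have a2 : 0 < v x := hx2
      linarith
    refine le_trans (b := ∫ x in {x | v x < 0}, fluxD v (v x) ^ 2 / (π - τ x) ∂μ) ?_ ?_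
    · rw [← hNr]
      apply integral_mono_ae _ (i2.mono_set hss)
      · refine (ae_restrict_iff' hNm).2 ?_
        filter_upwards [hrange] with x hx hx0
        apply div_le_div_of_nonneg_left (sq_nonneg _) (by linarith [hx.2])
        refine (o4 x).trans ?_
        have hx0' : v x < 0 := hx0
        have hfin : volume {y | v y ≤ v x} ≠ ⊤ := by
          refine (vol_fin (fun x => - v x) hc.neg (- v x) (by linarith) _ fun y hy => ?_).ne
          have : v y ≤ v x := hy
          linarith
        exact ENNReal.toReal_mono hfin (Measure.restrict_apply_le _ _)
      · rw [hNr]; exact ratio_neg_integrableOn v hv hc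
    · apply setIntegral_mono_set i2
      · refine ae_restrict_of_ae ?_
        filter_upwards [hrange] with x hx
        exact div_nonneg (sq_nonneg _) (by linarith [hx.2])
      · exact hss.eventuallyLE
  have d1 := dirichlet_bound v hv hc
  have d2 := ineq_i v hv hc
  rw [hPr] at core
  rw [hPr] at b1
  simp only [norm_gradient_eq, hσ]
  have d3 : ∫ x, v x ≤ 1 / (4 * π) * ∫ x in {x | 0 < v x}, fluxD v (v x) := by
    rw [one_div, inv_mul_eq_div, le_div_iff₀ (by positivity)]; linarith
  have d4 := mul_le_mul_of_nonneg_left (d1.trans (add_le_add b1 b2)) (by positivity : 0 ≤ κ / 2)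
  linarith

end PartE3

section PartD

/-- Bessel type entire series. -/
noncomputable def bser (m : ℕ) (x : ℝ) : ℝ := ∑' n : ℕ, x ^ n / ((n.factorial : ℝ) * ((n + m).factorial : ℝ))

theorem bser_term_le (m n : ℕ) (x : ℝ) :
    ‖x ^ n / ((n.factorial : ℝ) * ((n + m).factorial : ℝ))‖ ≤ |x| ^ n / (n.factorial : ℝ) := by
  rw [norm_div, norm_pow, Real.norm_eq_abs, Real.norm_eq_abs,
    abs_of_nonneg (by positivity : (0:ℝ) ≤ (n.factorial : ℝ) * ((n + m).factorial : ℝ))]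
  have h1 : (1:ℝ) ≤ ((n + m).factorial : ℝ) := by exact_mod_cast Nat.one_le_iff_ne_zero.2 (Nat.factorial_ne_zero _)
  have h2 : (0:ℝ) < (n.factorial : ℝ) := by positivity
  apply div_le_div_of_nonneg_left (by positivity) h2
  nlinarith

theorem bser_summable (m : ℕ) (x : ℝ) :
    Summable fun n : ℕ => x ^ n / ((n.factorial : ℝ) * ((n + m).factorial : ℝ)) :=
  Summable.of_norm_bounded (Real.summable_pow_div_factorial |x|) fun n => bser_term_le m n x

theorem bser_abs_le (m : ℕ) (x : ℝ) : |bser m x| ≤ exp |x| := by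
  have h := Real.summable_pow_div_factorial |x|
  have h2 := tsum_of_norm_bounded h.hasSum (fun n => bser_term_le m n x)
  rw [Real.norm_eq_abs] at h2
  refine h2.trans (le_of_eq ?_)
  rw [Real.exp_eq_exp_ℝ, NormedSpace.exp_eq_tsum_div]

theorem bser_zero (m : ℕ) : bser m 0 = 1 / (m.factorial : ℝ) := by
  unfold bser
  rw [tsum_eq_single 0]
  · simp
  · intro n hn; simp [hn]

theorem bser_hasDerivAt (m : ℕ) (x : ℝ) : HasDerivAt (bser m) (bser (m + 1) x) x := by
  set R := |x| + 1 with hR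
  have hR0 : 0 < R := by positivity
  have key := hasDerivAt_tsum_of_isPreconnected
    (g := fun (n : ℕ) (y : ℝ) => y ^ n / ((n.factorial : ℝ) * ((n + m).factorial : ℝ)))
    (g' := fun (n : ℕ) (y : ℝ) => (n * y ^ (n - 1)) / ((n.factorial : ℝ) * ((n + m).factorial : ℝ)))
    (u := fun n : ℕ => n * R ^ (n - 1) / (n.factorial : ℝ)) (t := Metric.ball 0 R) (y₀ := x) (y := x)
    ?_ Metric.isOpen_ball (convex_ball 0 R).isPreconnected ?_ ?_ ?_ (bser_summable m x) ?_
  · have e : (∑' n : ℕ, (n * x ^ (n - 1)) / ((n.factorial : ℝ) * ((n + m).factorial : ℝ))) = bser (m + 1) x := by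
      have hsum : Summable fun n : ℕ => (n * x ^ (n - 1)) / ((n.factorial : ℝ) * ((n + m).factorial : ℝ)) := by
        rw [← summable_nat_add_iff 1]
        refine (bser_summable (m + 1) x).congr fun n => ?_
        have : ((n + 1 : ℕ):ℝ) ≠ 0 := by positivity
        rw [Nat.factorial_succ, show n + 1 + m = n + (m + 1) by ring]
        simp only [Nat.add_sub_cancel]
        push_cast at this ⊢
        field_simp
      rw [hsum.tsum_eq_zero_add]
      simp only [Nat.cast_zero, zero_mul, zero_div, zero_add]
      unfold bser
      congr 1; ext n
      have : ((n + 1 : ℕ):ℝ) ≠ 0 := by positivity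
      rw [Nat.factorial_succ, show n + 1 + m = n + (m + 1) by ring]
      simp only [Nat.add_sub_cancel]
      push_cast at this ⊢
      field_simp
    rw [e] at key
    exact key
  · rw [← summable_nat_add_iff 1]
    refine (Real.summable_pow_div_factorial R).congr fun n => ?_
    have : ((n + 1 : ℕ):ℝ) ≠ 0 := by positivity
    rw [Nat.factorial_succ]
    simp only [Nat.add_sub_cancel]
    push_cast at this ⊢
    field_simp
  · intro n y _
    exact (hasDerivAt_pow n y).div_const _
  · intro n y hy
    rw [mem_ball_zero_iff, Real.norm_eq_abs] at hy
    rw [norm_div, norm_mul, norm_pow, Real.norm_eq_abs, Real.norm_eq_abs, Real.norm_eq_abs,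
      abs_of_nonneg (by positivity : (0:ℝ) ≤ n), abs_of_nonneg (by positivity : (0:ℝ) ≤ (n.factorial : ℝ) * ((n + m).factorial : ℝ))]
    have h1 : (1:ℝ) ≤ ((n + m).factorial : ℝ) := by exact_mod_cast Nat.one_le_iff_ne_zero.2 (Nat.factorial_ne_zero _)
    have h2 : (0:ℝ) < (n.factorial : ℝ) := by positivity
    apply div_le_div₀ (by positivity) _ h2 (by nlinarith)
    gcongr
  all_goals
    rw [mem_ball_zero_iff, Real.norm_eq_abs]; linarith

theorem bser_contDiff (n : ℕ) : ∀ m, ContDiff ℝ n (bser m) := by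
  induction n with
  | zero => 
    intro m
    rw [Nat.cast_zero, contDiff_zero]
    exact continuous_iff_continuousAt.2 fun x => (bser_hasDerivAt m x).continuousAt
  | succ n ih =>
    intro m
    push_cast
    rw [contDiff_succ_iff_deriv]
    refine ⟨fun x => (bser_hasDerivAt m x).differentiableAt, by simp, ?_⟩
    have : deriv (bser m) = bser (m + 1) := funext fun x => (bser_hasDerivAt m x).deriv
    rw [this]; exact ih _

theorem bser_rec (m : ℕ) (x : ℝ) : bser m x = (m + 1) * bser (m + 1) x + x * bser (m + 2) x := by
  unfold bser
  rw [← tsum_mul_left, ← tsum_mul_left, (bser_summable m x).tsum_eq_zero_add,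
    ((bser_summable (m + 1) x).mul_left ((m:ℝ) + 1)).tsum_eq_zero_add, add_assoc, ← Summable.tsum_add]
  · congr 1
    · simp only [pow_zero, Nat.factorial_zero, Nat.cast_one, one_mul, zero_add]
      rw [Nat.factorial_succ]; push_cast; field_simp
    · congr 1; ext n
      rw [show n + 1 + (m + 1) = (n + 1 + m) + 1 by ring, show n + (m + 2) = (n + 1 + m) + 1 by ring,
        Nat.factorial_succ (n + 1 + m), Nat.factorial_succ n]
      push_cast
      have : (n : ℝ) + 1 + m + 1 ≠ 0 := by positivity
      field_simp
      ring
  · have := (summable_nat_add_iff 1).2 (bser_summable (m + 1) x)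
    exact this.mul_left _
  · exact (bser_summable (m + 2) x).mul_left x

theorem ode_exists (κ : ℝ) (κ0 : 0 ≤ κ) (hκ : κ ≤ 1 / (4 * π)) :
    ∃ F g q : ℝ → ℝ, ContDiff ℝ (⊤ : ℕ∞) q ∧ (∀ s, HasDerivAt F (g s) s) ∧
      (∀ s, HasDerivAt g (-(1 / (4 * π)) - κ * q s) s) ∧ (∀ s, F s = s * q s) ∧ q π = 0 ∧
      (∀ s ∈ Set.Icc 0 π, F s ≤ π - s) := by
  have hpi := Real.pi_pos
  set φ : ℕ → ℝ → ℝ := fun m s => bser m (-κ * s) with hφ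
  have hd : ∀ m s, HasDerivAt (φ m) (-κ * φ (m + 1) s) s := by
    intro m s
    have h1 : HasDerivAt (fun s : ℝ => -κ * s) (-κ) s := by
      simpa using (hasDerivAt_id s).const_mul (-κ)
    have := (bser_hasDerivAt m (-κ * s)).comp s h1
    simp only [hφ]
    rw [mul_comm]
    exact this
  have hsm : ContDiff ℝ (⊤ : ℕ∞) (φ 2) := by
    have : ContDiff ℝ (⊤ : ℕ∞) (bser 2) := contDiff_infty.2 fun n => bser_contDiff n 2
    exact this.comp (by fun_prop)
  have hc := hsm.continuous
  set k : ℝ → ℝ := fun s => ∫ t in (0:ℝ)..s, φ 2 t with hk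
  have hkd : ∀ s, HasDerivAt k (φ 2 s) s := fun s =>
    intervalIntegral.integral_hasDerivAt_right (hc.intervalIntegrable _ _)
      (hc.stronglyMeasurableAtFilter _ _) hc.continuousAt
  have hk0 : k 0 = 0 := by simp [hk]
  have hksm : ContDiff ℝ (⊤ : ℕ∞) k := by
    rw [contDiff_infty_iff_deriv]
    refine ⟨fun s => (hkd s).differentiableAt, ?_⟩
    rw [show deriv k = φ 2 from funext fun s => (hkd s).deriv]
    exact hsm
  have hφ1 : ∀ s, φ 1 s = 1 - κ * k s := by
    have hdd : ∀ s, HasDerivAt (fun s => φ 1 s - (1 - κ * k s)) 0 s := by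
      intro s
      have := (hd 1 s).sub (((hkd s).const_mul κ).const_sub 1)
      refine this.congr_deriv ?_
      ring
    intro s
    have := is_const_of_deriv_eq_zero (fun s => (hdd s).differentiableAt) (fun s => (hdd s).deriv) s 0
    simp only [hk0] at this
    have h0 : φ 1 0 = 1 := by simp [hφ, bser_zero]
    rw [h0] at this
    linarith
  have hrec : ∀ s, 2 * φ 2 s + s * (-κ * φ 3 s) = 1 - κ * k s := by
    intro s
    rw [← hφ1]
    simp only [hφ]
    rw [bser_rec 1 (-κ * s)]
    push_cast; ring
  have hbd : ∀ s ∈ Set.Icc 0 π, |φ 2 s| ≤ 2 := by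
    rintro s ⟨s0, s1⟩
    refine (bser_abs_le 2 _).trans ?_
    have h1 : |-κ * s| ≤ 1 / 4 := by
      rw [neg_mul, abs_neg, abs_of_nonneg (by positivity)]
      calc κ * s ≤ (1 / (4 * π)) * π := by gcongr
        _ = 1 / 4 := by field_simp
    have h2 : exp (|-κ * s|) ≤ exp (1/4) := exp_le_exp.2 h1
    have h3 : exp (1/4 : ℝ) ≤ 1 / (1 - 1/4) := Real.exp_bound_div_one_sub_of_interval (by norm_num) (by norm_num)
    linarith
  have hlip : ∀ s ∈ Set.Icc 0 π, |k π - k s| ≤ 2 * (π - s) := by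
    rintro s ⟨s0, s1⟩
    have := Convex.norm_image_sub_le_of_norm_hasDerivWithin_le (f := k) (f' := φ 2) (s := Set.Icc 0 π) (C := 2)
      (fun x _ => (hkd x).hasDerivWithinAt) (fun x hx => hbd x hx) (convex_Icc _ _)
      (⟨s0, s1⟩ : s ∈ Set.Icc 0 π) (⟨hpi.le, le_rfl⟩ : π ∈ Set.Icc 0 π)
    rw [Real.norm_eq_abs, Real.norm_eq_abs, abs_of_nonneg (by linarith : 0 ≤ π - s)] at this
    exact this
  have hkpi : k π ≤ 2 * π := by
    have := hlip 0 ⟨le_rfl, hpi.le⟩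
    rw [hk0] at this
    have := le_abs_self (k π - 0)
    linarith
  have hden : 1 / 2 ≤ 1 - κ * k π := by
    have : κ * k π ≤ 1 / (4 * π) * (2 * π) := by
      calc κ * k π ≤ κ * (2 * π) := by gcongr
        _ ≤ _ := by gcongr
    have e : 1 / (4 * π) * (2 * π) = 1 / 2 := by field_simp; norm_num
    linarith
  set D := 1 - κ * k π with hD
  have hD0 : 0 < D := by linarith
  refine ⟨fun s => s * ((k π - k s) / (4 * π * D)), 
    fun s => ((k π - k s) - s * φ 2 s) / (4 * π * D), fun s => (k π - k s) / (4 * π * D), ?_, ?_, ?_, ?_, ?_, ?_⟩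
  · exact (contDiff_const.sub hksm).div_const _
  · intro s
    have := (hasDerivAt_id s).mul (((hkd s).const_sub (k π)).div_const (4 * π * D))
    refine this.congr_deriv ?_
    simp only [id]
    ring
  · intro s
    have := (((hkd s).const_sub (k π)).sub ((hasDerivAt_id s).mul (hd 2 s))).div_const (4 * π * D)
    refine this.congr_deriv ?_
    simp only [id]
    have e : -φ 2 s - (1 * φ 2 s + s * (-κ * φ (2 + 1) s)) = -(1 - κ * k s) := by
      rw [← hrec]; ring
    rw [e]
    field_simp
    rw [hD]; ring
  · intro s; rfl
  · simp
  · rintro s ⟨s0, s1⟩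
    have h1 := (le_abs_self _).trans (hlip s ⟨s0, s1⟩)
    have : s * ((k π - k s) / (4 * π * D)) ≤ π * (2 * (π - s) / (4 * π * (1/2))) := by
      have : (k π - k s) / (4 * π * D) ≤ 2 * (π - s) / (4 * π * (1/2)) := by
        apply div_le_div₀ (by linarith) h1 (by positivity)
        gcongr
      have h3 : 0 ≤ 2 * (π - s) / (4 * π * (1/2)) := div_nonneg (by linarith) (by positivity)
      calc _ ≤ s * (2 * (π - s) / (4 * π * (1/2))) := by gcongr
        _ ≤ _ := by gcongr
    refine this.trans (le_of_eq ?_)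
    field_simp
    ring
end PartD

section PartG
local notation "E2" => EuclideanSpace ℝ (Fin 2)

theorem radial_int (H : ℝ → ℝ) : ∫ x : E2, H (π * ‖x‖ ^ 2) = ∫ s in Set.Ioi (0:ℝ), H s := by
  have hpi := Real.pi_pos
  have h1 := integral_fun_norm_addHaar (volume : Measure E2) (fun r => H (π * r ^ 2))
  rw [h1]
  have hv : (volume : Measure E2).real (Metric.ball 0 1) = π := by
    rw [measureReal_def, EuclideanSpace.volume_ball_fin_two]
    simp [hpi.le]
  rw [hv]
  have hd : Module.finrank ℝ E2 = 2 := by simp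
  rw [hd]
  have him : (fun r : ℝ => π * r ^ 2) '' Set.Ioi 0 = Set.Ioi 0 := by
    ext s
    constructor
    · rintro ⟨r, hr, rfl⟩
      have hr' : 0 < r := hr
      exact (by positivity : 0 < π * r ^ 2)
    · intro hs
      have hs' : 0 < s := hs
      refine ⟨√(s / π), Real.sqrt_pos.2 (by positivity), ?_⟩
      simp only
      rw [Real.sq_sqrt (by positivity)]
      field_simp
  have h2 := integral_image_eq_integral_abs_deriv_smul (s := Set.Ioi (0:ℝ)) (f := fun r => π * r ^ 2)
    (f' := fun r => π * (2 * r)) measurableSet_Ioi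
    (fun r _ => by
      have := ((hasDerivAt_pow 2 r).const_mul π).hasDerivWithinAt (s := Set.Ioi (0:ℝ))
      simpa using this)
    (by
      intro a ha b hb hab
      simp only at hab
      have := mul_left_cancel₀ hpi.ne' hab
      exact (pow_left_inj₀ (le_of_lt ha) (le_of_lt hb) two_ne_zero).1 this) H
  rw [him] at h2
  rw [h2]
  rw [nsmul_eq_mul, smul_eq_mul, ← integral_const_mul, ← integral_const_mul]
  apply setIntegral_congr_fun measurableSet_Ioi
  intro r hr
  have hr' : 0 < r := hr
  simp only [smul_eq_mul]
  rw [abs_of_pos (by positivity)]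
  push_cast
  ring

theorem radial_int_pi (H : ℝ → ℝ) (hH : ∀ s, π ≤ s → H s = 0) :
    ∫ x : E2, H (π * ‖x‖ ^ 2) = ∫ s in (0:ℝ)..π, H s := by
  rw [radial_int, intervalIntegral.integral_of_le Real.pi_pos.le]
  apply setIntegral_eq_of_subset_of_forall_sdiff_eq_zero measurableSet_Ioi
  · exact Set.Ioc_subset_Ioi_self
  · rintro s ⟨hs1, hs2⟩
    apply hH
    by_contra h
    exact hs2 ⟨hs1, by linarith⟩

theorem radial_fderiv (W W1 : ℝ → ℝ) (h1 : ∀ s, HasDerivAt W (W1 s) s) (x : E2) :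
    HasFDerivAt (fun x : E2 => W (π * ‖x‖ ^ 2)) ((W1 (π * ‖x‖ ^ 2) * (2 * π)) • innerSL ℝ x) x := by
  have h := (hasStrictFDerivAt_norm_sq x).hasFDerivAt.const_mul π
  have := (h1 (π * ‖x‖ ^ 2)).comp_hasFDerivAt x h
  refine this.congr_fderiv ?_
  ext y
  simp
  ring

theorem radial_grad (W W1 : ℝ → ℝ) (h1 : ∀ s, HasDerivAt W (W1 s) s) (x : E2) :
    ‖gradient (fun x : E2 => W (π * ‖x‖ ^ 2)) x‖ ^ 2 = 4 * π * ((π * ‖x‖ ^ 2) * W1 (π * ‖x‖ ^ 2) ^ 2) := by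
  rw [norm_gradient_eq, (radial_fderiv W W1 h1 x).fderiv, norm_smul, innerSL_apply_norm, mul_pow, Real.norm_eq_abs,
    sq_abs]
  ring

theorem radial_lap (W W1 W2 : ℝ → ℝ) (h1 : ∀ s, HasDerivAt W (W1 s) s) (h2 : ∀ s, HasDerivAt W1 (W2 s) s) (x : E2) :
    laplacian (fun x : E2 => W (π * ‖x‖ ^ 2)) x =
      4 * π * ((π * ‖x‖ ^ 2) * W2 (π * ‖x‖ ^ 2) + W1 (π * ‖x‖ ^ 2)) := by
  unfold laplacian
  have e : ∀ i : Fin 2, fderiv ℝ (fun y : E2 => fderiv ℝ (fun x : E2 => W (π * ‖x‖ ^ 2)) y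
      (EuclideanSpace.single i 1)) x (EuclideanSpace.single i 1) =
      4 * π * (π * W2 (π * ‖x‖ ^ 2) * (x i) ^ 2) + 2 * π * W1 (π * ‖x‖ ^ 2) := by
    intro i
    have e1 : (fun y : E2 => fderiv ℝ (fun x : E2 => W (π * ‖x‖ ^ 2)) y (EuclideanSpace.single i 1)) =
        fun y : E2 => W1 (π * ‖y‖ ^ 2) * ((2 * π) * (EuclideanSpace.proj i : E2 →L[ℝ] ℝ) y) := by
      ext y
      rw [(radial_fderiv W W1 h1 y).fderiv]
      simp [EuclideanSpace.inner_single_right]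
      ring
    rw [e1]
    have := (radial_fderiv W1 W2 h2 x).mul
      (((EuclideanSpace.proj i : E2 →L[ℝ] ℝ).hasFDerivAt (x := x)).const_mul (2 * π))
    have h3 : fderiv ℝ (fun y : E2 => W1 (π * ‖y‖ ^ 2) * ((2 * π) * (EuclideanSpace.proj i : E2 →L[ℝ] ℝ) y)) x = _ :=
      this.fderiv
    rw [h3]
    simp [EuclideanSpace.inner_single_right]
    ring
  rw [Finset.sum_congr rfl (fun i _ => e i), Fin.sum_univ_two, EuclideanSpace.norm_sq_eq, Fin.sum_univ_two]
  simp only [Real.norm_eq_abs, sq_abs]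
  ring

theorem radial_supp (W : ℝ → ℝ) (δ : ℝ) (hδ : 0 < δ) (hW : ∀ s, π - δ ≤ s → W s = 0) :
    HasCompactSupport (fun x : E2 => W (π * ‖x‖ ^ 2)) ∧
      tsupport (fun x : E2 => W (π * ‖x‖ ^ 2)) ⊆ Metric.ball (0 : E2) 1 := by
  have hpi := Real.pi_pos
  have hcl : IsClosed {x : E2 | π * ‖x‖ ^ 2 ≤ π - δ} := isClosed_le (by fun_prop) (by fun_prop)
  have hts : tsupport (fun x : E2 => W (π * ‖x‖ ^ 2)) ⊆ {x : E2 | π * ‖x‖ ^ 2 ≤ π - δ} := by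
    apply closure_minimal _ hcl
    intro x hx
    by_contra h
    simp only [Set.mem_ofPred_eq, not_le] at h
    exact hx (hW _ h.le)
  have hb : {x : E2 | π * ‖x‖ ^ 2 ≤ π - δ} ⊆ Metric.ball (0 : E2) 1 := by
    intro x hx
    simp only [Set.mem_ofPred_eq] at hx
    rw [mem_ball_zero_iff]
    by_contra h
    rw [not_lt] at h
    have : 1 ≤ ‖x‖ ^ 2 := one_le_pow₀ h
    nlinarith
  refine ⟨?_, hts.trans hb⟩
  apply HasCompactSupport.of_support_subset_isCompact (isCompact_closedBall (0 : E2) 1)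
  exact (subset_tsupport _).trans ((hts.trans hb).trans Metric.ball_subset_closedBall)

theorem radial_J (W W1 W2 : ℝ → ℝ) (h1 : ∀ s, HasDerivAt W (W1 s) s) (h2 : ∀ s, HasDerivAt W1 (W2 s) s)
    (z : ∀ s, π ≤ s → W s = 0 ∧ W1 s = 0 ∧ W2 s = 0) (σ : ℝ) :
    (1/2) * (∫ x, (laplacian (fun x : E2 => W (π * ‖x‖ ^ 2)) x)^2)
      - (σ^2/2) * (∫ x, ‖gradient (fun x : E2 => W (π * ‖x‖ ^ 2)) x‖^2) - ∫ x : E2, W (π * ‖x‖ ^ 2) =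
    (1/2) * (∫ s in (0:ℝ)..π, (4 * π * (s * W2 s + W1 s)) ^ 2)
      - (σ^2/2) * (∫ s in (0:ℝ)..π, 4 * π * (s * W1 s ^ 2)) - ∫ s in (0:ℝ)..π, W s := by
  simp only [radial_lap W W1 W2 h1 h2, radial_grad W W1 h1]
  rw [radial_int_pi (fun s => (4 * π * (s * W2 s + W1 s)) ^ 2) (fun s hs => by simp [z s hs]),
    radial_int_pi (fun s => 4 * π * (s * W1 s ^ 2)) (fun s hs => by simp [z s hs]),
    radial_int_pi W (fun s hs => (z s hs).1)]

end PartG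

section PartH
local notation "E2" => EuclideanSpace ℝ (Fin 2)
open Filter Topology

theorem smooth_prim (f : ℝ → ℝ) (hf : ContDiff ℝ (⊤ : ℕ∞) f) (a : ℝ) :
    (∀ s, HasDerivAt (fun s => ∫ t in a..s, f t) (f s) s) ∧ ContDiff ℝ (⊤ : ℕ∞) (fun s => ∫ t in a..s, f t) := by
  have hc := hf.continuous
  have hd : ∀ s, HasDerivAt (fun s => ∫ t in a..s, f t) (f s) s := fun s =>
    intervalIntegral.integral_hasDerivAt_right (hc.intervalIntegrable _ _)
      (hc.stronglyMeasurableAtFilter _ _) hc.continuousAt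
  refine ⟨hd, ?_⟩
  rw [contDiff_infty_iff_deriv]
  refine ⟨fun s => (hd s).differentiableAt, ?_⟩
  rw [show deriv (fun s => ∫ t in a..s, f t) = f from funext fun s => (hd s).deriv]
  exact hf

/-- Bounded convergence on a subinterval of `[0, π]`. -/
theorem bdd_conv (f : ℕ → ℝ → ℝ) (f0 : ℝ → ℝ) (C : ℝ) (a b : ℝ) (ha : a ∈ Set.Icc 0 π) (hb : b ∈ Set.Icc 0 π)
    (hc : ∀ n, Continuous (f n)) (hC : ∀ n, ∀ s ∈ Set.Icc 0 π, |f n s| ≤ C)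
    (hl : ∀ s ∈ Set.Ico 0 π, Tendsto (fun n => f n s) atTop (𝓝 (f0 s))) :
    Tendsto (fun n => ∫ s in a..b, f n s) atTop (𝓝 (∫ s in a..b, f0 s)) := by
  have hsub : ∀ s ∈ Set.uIoc a b, s ∈ Set.Icc 0 π := fun s hs =>
    (Set.uIcc_subset_Icc ha hb) (Set.uIoc_subset_uIcc hs)
  apply intervalIntegral.tendsto_integral_filter_of_dominated_convergence (fun _ => C)
  · exact Eventually.of_forall fun n => (hc n).aestronglyMeasurable
  · exact Eventually.of_forall fun n => Eventually.of_forall fun s hs => hC n s (hsub s hs)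
  · exact intervalIntegrable_const
  · have : ∀ᵐ s : ℝ, s ≠ π := by
      rw [ae_iff]; simp
    filter_upwards [this] with s hs hs2
    have := hsub s hs2
    exact hl s ⟨this.1, lt_of_le_of_ne this.2 hs⟩

theorem approx_J (F g q : ℝ → ℝ) (κ σ : ℝ) (hσ : σ ^ 2 = 4 * π * κ) (hq : ContDiff ℝ (⊤ : ℕ∞) q)
    (hF : ∀ s, HasDerivAt F (g s) s)
    (hg : ∀ s, HasDerivAt g (-(1 / (4 * π)) - κ * q s) s) (hFq : ∀ s, F s = s * q s) (qpi : q π = 0)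
    (ε : ℝ) (hε : 0 < ε) :
    ∃ w : E2 → ℝ, ContDiff ℝ (⊤ : ℕ∞) w ∧ HasCompactSupport w ∧ tsupport w ⊆ Metric.ball (0 : E2) 1 ∧
      (1/2) * (∫ x, (laplacian w x)^2) - (σ^2/2) * (∫ x, ‖gradient w x‖^2) - ∫ x, w x
        < -(1 / (8 * π)) * (∫ s in (0:ℝ)..π, F s) + ε := by
  have hpi := Real.pi_pos
  have hqd := contDiff_infty_iff_deriv.1 hq
  set h : ℝ → ℝ := fun s => -(deriv q s) / (4 * π) with hh
  have hhs : ContDiff ℝ (⊤ : ℕ∞) h := hqd.2.neg.div_const _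
  have hqh : ∀ s, HasDerivAt (fun s => -q s / (4 * π)) (h s) s := fun s =>
    ((hqd.1 s).hasDerivAt.neg.div_const _)
  set P : ℝ → ℝ := fun s => -q s / (4 * π) with hP
  have hPs : ContDiff ℝ (⊤ : ℕ∞) P := hq.neg.div_const _
  set Q : ℝ → ℝ := fun s => ∫ t in π..s, P t with hQ
  have hQd : ∀ s, HasDerivAt Q (P s) s := (smooth_prim P hPs π).1
  have hPint : ∀ s, P s = ∫ t in π..s, h t := by
    intro s
    rw [intervalIntegral.integral_eq_sub_of_hasDerivAt (fun t _ => hqh t) (hhs.continuous.intervalIntegrable _ _)]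
    simp [hP, qpi]
  -- the cutoffs
  set η : ℕ → ℝ → ℝ := fun n s => Real.smoothTransition ((n + 1 : ℝ) * (π - s) - 1) with hη
  have hηs : ∀ n, ContDiff ℝ (⊤ : ℕ∞) (η n) := fun n =>
    Real.smoothTransition.contDiff.comp (by fun_prop)
  have hη0 : ∀ (n : ℕ) (s : ℝ), π - 1 / ((n:ℝ) + 1) ≤ s → η n s = 0 := by
    intro n s hs
    apply Real.smoothTransition.zero_of_nonpos
    have h1 : π - s ≤ 1 / ((n:ℝ) + 1) := by linarith
    rw [le_div_iff₀ (by positivity)] at h1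
    linarith
  have hη1 : ∀ s, s < π → ∀ᶠ n in atTop, η n s = 1 := by
    intro s hs
    obtain ⟨N, hN⟩ := exists_nat_gt (2 / (π - s))
    filter_upwards [eventually_ge_atTop N] with n hn
    apply Real.smoothTransition.one_of_one_le
    have h1 : (N:ℝ) ≤ n := by exact_mod_cast hn
    have h2 : 2 / (π - s) < (n:ℝ) + 1 := by linarith
    rw [div_lt_iff₀ (by linarith)] at h2
    linarith
  have hηb : ∀ n s, |η n s| ≤ 1 := fun n s => by
    rw [abs_of_nonneg (Real.smoothTransition.nonneg _)]
    exact Real.smoothTransition.le_one _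
  set hn : ℕ → ℝ → ℝ := fun n s => h s * η n s with hhn
  have hns : ∀ n, ContDiff ℝ (⊤ : ℕ∞) (hn n) := fun n => hhs.mul (hηs n)
  set Pn : ℕ → ℝ → ℝ := fun n s => ∫ t in π..s, hn n t with hPn
  have Pns := fun n => smooth_prim (hn n) (hns n) π
  set Qn : ℕ → ℝ → ℝ := fun n s => ∫ t in π..s, Pn n t with hQn
  have Qns := fun n => smooth_prim (Pn n) (Pns n).2 π
  -- vanishing near the boundary
  have zint : ∀ (n : ℕ) (f : ℝ → ℝ), (∀ s, π - 1 / ((n:ℝ) + 1) ≤ s → f s = 0) →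
      ∀ s, π - 1 / ((n:ℝ) + 1) ≤ s → ∫ t in π..s, f t = 0 := by
    intro n f hf s hs
    apply intervalIntegral.integral_zero_ae
    refine Eventually.of_forall fun t ht => hf t ?_
    have := ht.1
    have hpos : 0 < 1 / ((n:ℝ) + 1) := by positivity
    have h2 : π - 1 / ((n:ℝ) + 1) ≤ min π s := le_min (by linarith) hs
    linarith
  have zh : ∀ (n : ℕ) s, π - 1 / ((n:ℝ) + 1) ≤ s → hn n s = 0 := fun n s hs => by
    simp only [hhn]; rw [hη0 n s hs, mul_zero]
  have zP : ∀ (n : ℕ) s, π - 1 / ((n:ℝ) + 1) ≤ s → Pn n s = 0 := fun n => zint n _ (zh n)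
  have zQ : ∀ (n : ℕ) s, π - 1 / ((n:ℝ) + 1) ≤ s → Qn n s = 0 := fun n => zint n _ (zP n)
  -- bounds
  obtain ⟨C, hC⟩ := isCompact_Icc.exists_bound_of_continuousOn (s := Set.Icc 0 π) hhs.continuous.continuousOn
  have C0 : 0 ≤ C := (norm_nonneg _).trans (hC 0 ⟨le_rfl, hpi.le⟩)
  have bh : ∀ n, ∀ s ∈ Set.Icc 0 π, |hn n s| ≤ C := by
    intro n s hs
    simp only [hhn]
    rw [abs_mul]
    have := hC s hs
    rw [Real.norm_eq_abs] at this
    calc |h s| * |η n s| ≤ C * 1 := by gcongr; exact hηb n s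
      _ = C := mul_one _
  have bint : ∀ (f : ℝ → ℝ) (K : ℝ), 0 ≤ K → (∀ s ∈ Set.Icc 0 π, |f s| ≤ K) →
      ∀ s ∈ Set.Icc 0 π, |∫ t in π..s, f t| ≤ K * π := by
    intro f K K0 hf s hs
    have hb : ‖∫ t in π..s, f t‖ ≤ K * |s - π| := by
      apply intervalIntegral.norm_integral_le_of_norm_le_const
      intro t ht
      exact hf t ((Set.uIcc_subset_Icc ⟨hpi.le, le_rfl⟩ hs) (Set.uIoc_subset_uIcc ht))
    rw [Real.norm_eq_abs] at hb
    refine hb.trans ?_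
    gcongr
    rw [abs_le]; constructor <;> linarith [hs.1, hs.2]
  have bP : ∀ n, ∀ s ∈ Set.Icc 0 π, |Pn n s| ≤ C * π := fun n => bint _ C C0 (bh n)
  have bQ : ∀ n, ∀ s ∈ Set.Icc 0 π, |Qn n s| ≤ C * π * π := fun n => bint _ _ (by positivity) (bP n)
  -- limits
  have lh : ∀ s ∈ Set.Ico 0 π, Tendsto (fun n => hn n s) atTop (𝓝 (h s)) := by
    intro s hs
    apply tendsto_const_nhds.congr'
    filter_upwards [hη1 s hs.2] with n hn1
    simp only [hhn]
    rw [hn1, mul_one]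
  have lP : ∀ s ∈ Set.Ico 0 π, Tendsto (fun n => Pn n s) atTop (𝓝 (P s)) := by
    intro s hs
    rw [hPint]
    exact bdd_conv hn h C π s ⟨hpi.le, le_rfl⟩ ⟨hs.1, hs.2.le⟩ (fun n => (hns n).continuous) bh lh
  have lQ : ∀ s ∈ Set.Ico 0 π, Tendsto (fun n => Qn n s) atTop (𝓝 (Q s)) := by
    intro s hs
    exact bdd_conv Pn P _ π s ⟨hpi.le, le_rfl⟩ ⟨hs.1, hs.2.le⟩ (fun n => (Pns n).2.continuous) bP lP
  have m0 : (0:ℝ) ∈ Set.Icc 0 π := ⟨le_rfl, hpi.le⟩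
  have mpi : π ∈ Set.Icc 0 π := ⟨hpi.le, le_rfl⟩
  have L1 := bdd_conv (fun n s => (4 * π * (s * hn n s + Pn n s)) ^ 2) (fun s => (4 * π * (s * h s + P s)) ^ 2)
    ((4 * π * (π * C + C * π)) ^ 2) 0 π m0 mpi
    (fun n => by
      have a1 := (hns n).continuous
      have a2 := (Pns n).2.continuous
      exact (continuous_const.mul ((continuous_id.mul a1).add a2)).pow 2)
    (fun n s hs => by
      rw [abs_pow, abs_mul, abs_of_pos (by positivity : 0 < 4 * π)]
      have : |s * hn n s + Pn n s| ≤ π * C + C * π := by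
        refine (abs_add_le _ _).trans ?_
        rw [abs_mul]
        have h1 : |s| ≤ π := by rw [abs_of_nonneg hs.1]; exact hs.2
        exact add_le_add (mul_le_mul h1 (bh n s hs) (abs_nonneg _) hpi.le) (bP n s hs)
      gcongr)
    (fun s hs => (((tendsto_const_nhds.mul (lh s hs)).add (lP s hs)).const_mul _).pow 2)
  have L2 := bdd_conv (fun n s => 4 * π * (s * Pn n s ^ 2)) (fun s => 4 * π * (s * P s ^ 2))
    (4 * π * (π * (C * π) ^ 2)) 0 π m0 mpi
    (fun n => by
      have a2 := (Pns n).2.continuous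
      exact (continuous_const.mul (continuous_id.mul (a2.pow 2))))
    (fun n s hs => by
      rw [abs_mul, abs_of_pos (by positivity : 0 < 4 * π), abs_mul, abs_pow]
      have h1 : |s| ≤ π := by rw [abs_of_nonneg hs.1]; exact hs.2
      have h2 := bP n s hs
      gcongr)
    (fun s hs => ((tendsto_const_nhds.mul ((lP s hs).pow 2)).const_mul _))
  have L3 := bdd_conv Qn Q (C * π * π) 0 π m0 mpi (fun n => (Qns n).2.continuous) bQ lQ
  have L := ((L1.const_mul (1/2)).sub (L2.const_mul (σ^2/2))).sub L3
  -- identify the limit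
  have hgc : Continuous g := continuous_iff_continuousAt.2 fun s => (hg s).continuousAt
  have hFc : Continuous F := continuous_iff_continuousAt.2 fun s => (hF s).continuousAt
  have hQc : Continuous Q := continuous_iff_continuousAt.2 fun s => (hQd s).continuousAt
  have hPc := hPs.continuous
  have hhc := hhs.continuous
  have hgP : ∀ s, 4 * π * (s * h s + P s) = - g s := by
    intro s
    have h1 := (hasDerivAt_id s).mul (hqd.1 s).hasDerivAt
    have h2 : HasDerivAt F (1 * q s + id s * deriv q s) s := by
      refine h1.congr_of_eventuallyEq (Eventually.of_forall fun t => ?_)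
      rw [hFq]; rfl
    rw [(hF s).unique h2]
    simp only [hh, hP, id]
    field_simp
    ring
  have key : (1/2) * (∫ s in (0:ℝ)..π, (4 * π * (s * h s + P s)) ^ 2)
      - (σ^2/2) * (∫ s in (0:ℝ)..π, 4 * π * (s * P s ^ 2)) - (∫ s in (0:ℝ)..π, Q s)
      = -(1 / (8 * π)) * (∫ s in (0:ℝ)..π, F s) := by
    have i1 : IntervalIntegrable (fun s => (1/2) * (4 * π * (s * h s + P s)) ^ 2) volume 0 π :=
      Continuous.intervalIntegrable (by fun_prop) _ _
    have i2 : IntervalIntegrable (fun s => (σ^2/2) * (4 * π * (s * P s ^ 2))) volume 0 π :=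
      Continuous.intervalIntegrable (by fun_prop) _ _
    have i3 : IntervalIntegrable Q volume 0 π := hQc.intervalIntegrable _ _
    have i4 : IntervalIntegrable (fun s => (1 / (8 * π)) * F s) volume 0 π :=
      Continuous.intervalIntegrable (by fun_prop) _ _
    have ft : ∫ s in (0:ℝ)..π, ((((1/2) * (4 * π * (s * h s + P s)) ^ 2 - (σ^2/2) * (4 * π * (s * P s ^ 2))) - Q s)
        + (1 / (8 * π)) * F s) = ((1/2) * (F π * g π) - π * Q π) - ((1/2) * (F 0 * g 0) - 0 * Q 0) := by
      apply intervalIntegral.integral_eq_sub_of_hasDerivAt (f := fun s => (1/2) * (F s * g s) - s * Q s)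
      · intro s _
        have := (((hF s).mul (hg s)).const_mul (1/2)).sub ((hasDerivAt_id s).mul (hQd s))
        refine this.congr_deriv ?_
        rw [hgP, hσ]
        simp only [hP, hFq, id]
        field_simp
        ring
      · exact ((i1.sub i2).sub i3).add i4
    rw [intervalIntegral.integral_add ((i1.sub i2).sub i3) i4,
      intervalIntegral.integral_sub (i1.sub i2) i3, intervalIntegral.integral_sub i1 i2,
      intervalIntegral.integral_const_mul (1/2), intervalIntegral.integral_const_mul (σ^2/2),
      intervalIntegral.integral_const_mul (1 / (8 * π))] at ft
    have q1 : Q π = 0 := by simp [hQ]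
    rw [hFq π, hFq 0, qpi, q1] at ft
    linarith
  rw [key] at L
  have ev := L.eventually (eventually_lt_nhds (show -(1 / (8 * π)) * (∫ s in (0:ℝ)..π, F s) <
    -(1 / (8 * π)) * (∫ s in (0:ℝ)..π, F s) + ε by linarith))
  obtain ⟨n, hnn⟩ := ev.exists
  have hpos : 0 < 1 / ((n:ℝ) + 1) := by positivity
  refine ⟨fun x => Qn n (π * ‖x‖ ^ 2), ?_, (radial_supp _ _ hpos (zQ n)).1, (radial_supp _ _ hpos (zQ n)).2, ?_⟩
  · exact (Qns n).2.comp (contDiff_const.mul (contDiff_norm_sq ℝ))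
  · rw [radial_J (Qn n) (Pn n) (hn n) (Qns n).1 (Pns n).1
      (fun s hs => ⟨zQ n s (by linarith), zP n s (by linarith), zh n s (by linarith)⟩) σ]
    exact hnn

theorem main_proof :
    ∃ σ₂ : ℝ, 0 < σ₂ ∧ ∀ σ ∈ Set.Icc (0:ℝ) σ₂,
      ∀ Ω : Set (EuclideanSpace ℝ (Fin 2)), IsOpen Ω → volume Ω = ENNReal.ofReal π →
      ∀ v : EuclideanSpace ℝ (Fin 2) → ℝ,
        ContDiff ℝ (⊤ : ℕ∞) v → HasCompactSupport v → tsupport v ⊆ Ω →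
      (1/2) * (∫ x, (laplacian v x)^2) - (σ^2/2) * (∫ x, ‖gradient v x‖^2) - ∫ x, v x ≥
        sInf { e : ℝ | ∃ w : EuclideanSpace ℝ (Fin 2) → ℝ,
          ContDiff ℝ (⊤ : ℕ∞) w ∧ HasCompactSupport w ∧
          tsupport w ⊆ Metric.ball (0 : EuclideanSpace ℝ (Fin 2)) 1 ∧
          e = (1/2) * (∫ x, (laplacian w x)^2) - (σ^2/2) * (∫ x, ‖gradient w x‖^2)
                - ∫ x, w x } := by
  have hpi := Real.pi_pos
  refine ⟨1, one_pos, ?_⟩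
  rintro σ ⟨σ0, σ1⟩ Ω hΩ hvol v hv hc hsub
  set κ := σ ^ 2 / (4 * π) with hκ
  have hσ : σ ^ 2 = 4 * π * κ := by rw [hκ]; field_simp
  have κ0 : 0 ≤ κ := by positivity
  have κ1 : κ ≤ 1 / (4 * π) := by
    rw [hκ]; gcongr; exact pow_le_one₀ σ0 σ1
  obtain ⟨F, g, q, hq, hF, hg, hFq, qpi, hM⟩ := ode_exists κ κ0 κ1
  have κ2 : κ * π ≤ 1 / 2 := by
    calc κ * π ≤ 1 / (4 * π) * π := by gcongr
      _ = 1 / 4 := by field_simp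
      _ ≤ 1 / 2 := by norm_num
  have LB : ∀ (Ω : Set E2), IsOpen Ω → volume Ω = ENNReal.ofReal π → ∀ v : E2 → ℝ,
      ContDiff ℝ (⊤ : ℕ∞) v → HasCompactSupport v → tsupport v ⊆ Ω →
      -(1 / (8 * π)) * (∫ s in (0:ℝ)..π, F s) ≤
      (1/2) * (∫ x, (laplacian v x)^2) - (σ^2/2) * (∫ x, ‖gradient v x‖^2) - ∫ x, v x := by
    intro Ω hΩ hvol v hv hc hsub
    have hv2 : ContDiff ℝ 2 v := (contDiff_infty.1 hv 2)
    exact lower_bound Ω hΩ hvol v hv2 hc hsub F g q σ κ 1 hσ hF hg hq.continuous hFq (by rw [hFq, qpi, mul_zero])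
      (fun s hs => by rw [one_mul]; exact hM s hs) κ0 κ2 (by rw [mul_one]; exact κ1)
  refine le_trans ?_ (LB Ω hΩ hvol v hv hc hsub)
  have hball : volume (Metric.ball (0 : E2) 1) = ENNReal.ofReal π := by
    rw [EuclideanSpace.volume_ball_fin_two]
    simp [ENNReal.ofReal, Real.toNNReal_of_nonneg hpi.le]
  apply le_of_forall_pos_le_add
  intro ε hε
  obtain ⟨w, w1, w2, w3, w4⟩ := approx_J F g q κ σ hσ hq hF hg hFq qpi ε hε
  refine le_trans (csInf_le ?_ ⟨w, w1, w2, w3, rfl⟩) w4.le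
  refine ⟨-(1 / (8 * π)) * (∫ s in (0:ℝ)..π, F s), ?_⟩
  rintro e ⟨w, w1, w2, w3, rfl⟩
  exact LB _ Metric.isOpen_ball hball w w1 w2 w3

end PartH

/-- The disk minimizes the clamped-plate energy under sufficiently small compression:
there is `σ₂ > 0` such that for all `σ ∈ [0,σ₂]`, any open `Ω ⊆ ℝ²` of area `π`,
and any smooth compactly supported `v` with support in `Ω`, the energy
`(1/2)∫(Δv)² − (σ²/2)∫|∇v|² − ∫v` is at least the infimum of the same energy over
smooth functions compactly supported in the open unit disk. -/
theorem stmt_10 :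
    ∃ σ₂ : ℝ, 0 < σ₂ ∧ ∀ σ ∈ Set.Icc (0:ℝ) σ₂,
      ∀ Ω : Set (EuclideanSpace ℝ (Fin 2)), IsOpen Ω → volume Ω = ENNReal.ofReal π →
      ∀ v : EuclideanSpace ℝ (Fin 2) → ℝ,
        ContDiff ℝ (⊤ : ℕ∞) v → HasCompactSupport v → tsupport v ⊆ Ω →
      (1/2) * (∫ x, (laplacian v x)^2) - (σ^2/2) * (∫ x, ‖gradient v x‖^2) - ∫ x, v x ≥
        sInf { e : ℝ | ∃ w : EuclideanSpace ℝ (Fin 2) → ℝ,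
          ContDiff ℝ (⊤ : ℕ∞) w ∧ HasCompactSupport w ∧
          tsupport w ⊆ Metric.ball (0 : EuclideanSpace ℝ (Fin 2)) 1 ∧
          e = (1/2) * (∫ x, (laplacian w x)^2) - (σ^2/2) * (∫ x, ‖gradient w x‖^2)
                - ∫ x, w x } := by
  exact main_proof
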